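/- Let (w(k) : k ≥ 1) be nonnegative reals with ρ := (limsup_{k→∞} w(k)^{1/k})^{−1} > 0, fix b ∈ (0, ρ), set a = (Σ_{k≥0} (k+1)w(k+1)b^k)^{−1} and c = (Σ_{k≥1} w(k)b^k)^{−1} (assumed positive and finite), and define μ(k) = a(k+1)w(k+1)b^k for k ≥ 0 and μ_∅(k) = c·w(k)b^k for k ≥ 1. Then for every n ≥ 1, Z_n^w = BGW^{μ_∅,μ}(T_n) / (c·(ab)^{n−1}), where BGW^{μ_∅,μ}(T_n) is the total mass given by the modified Bienaymé–Galton–Watson measure to plane trees with n vertices. -/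

import Mathlib

open Filter Set

noncomputable section

/-- The position `e^{-2iπk/n}` of the `k`-th among the `n`-th roots of unity,
labelled in clockwise order starting from the complex number `1`. -/
def ncPos (n k : ℕ) : ℂ := Complex.exp (-(2 * Real.pi * Complex.I) * k / n)

/-- A noncrossing tree with `n` vertices: a tree on the vertex set of `n`-th roots of unity
whose edges, drawn as straight line segments, pairwise intersect only at common endpoints. -/
structure NCTree (n : ℕ) where
  adj : SimpleGraph (Fin n)
  isTree : adj.IsTree
  noncrossing : ∀ a b c d : Fin n, adj.Adj a b → adj.Adj c d →
    ({(a : ℕ), (b : ℕ)} : Set ℕ) ≠ {(c : ℕ), (d : ℕ)} →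
    segment ℝ (ncPos n a) (ncPos n b) ∩ segment ℝ (ncPos n c) (ncPos n d) ⊆
      {z : ℂ | (z = ncPos n a ∨ z = ncPos n b) ∧ (z = ncPos n c ∨ z = ncPos n d)}

/-- A plane tree in Neveu's formalism: a finite set of finite words of positive integers,
containing the root `[]`, closed under prefixes, and such that the children of a vertex `u`
are `u1, …, u k_u`. -/
structure PlaneTree where
  verts : Finset (List ℕ)
  root_mem : [] ∈ verts
  prefix_closed : ∀ u v : List ℕ, u <+: v → v ∈ verts → u ∈ verts
  labels_pos : ∀ u ∈ verts, ∀ i ∈ u, 1 ≤ i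
  children_closed : ∀ (u : List ℕ) (i : ℕ), 1 ≤ i → u ++ [i + 1] ∈ verts → u ++ [i] ∈ verts

namespace PlaneTree

/-- The number of children of the vertex `u` in `τ`. -/
def kc (τ : PlaneTree) (u : List ℕ) : ℕ := Set.ncard {i : ℕ | u ++ [i] ∈ τ.verts}

/-- The number of strict descendants of `u` in `τ`. -/
def descCount (τ : PlaneTree) (u : List ℕ) : ℕ :=
  Set.ncard {v : List ℕ | v ∈ τ.verts ∧ u <+: v ∧ v ≠ u}

/-- The number of vertices of the subtree grafted on `u` (that is, `u` and its descendants). -/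
def subtreeSize (τ : PlaneTree) (u : List ℕ) : ℕ :=
  Set.ncard {v : List ℕ | v ∈ τ.verts ∧ u <+: v}

/-- The height of `τ`: the maximal generation of a vertex. -/
def height (τ : PlaneTree) : ℕ := τ.verts.sup List.length

/-- The `j`-th vertex of `τ` in lexicographical order (starting from `j = 0` for the root). -/
def lexVertex (τ : PlaneTree) (j : ℕ) : List ℕ := (τ.verts.sort (· ≤ ·)).getD j []

/-- The Łukasiewicz path of `τ`: `W 0 = 0` and `W (j+1) = W j + k_{u(j)} - 1`, the vertices
being listed in lexicographical order. -/
def lukas (τ : PlaneTree) (j : ℕ) : ℤ :=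
  (((τ.verts.sort (· ≤ ·)).take j).map fun u => (τ.kc u : ℤ) - 1).sum

end PlaneTree

/-- `IsShape n θ τ f` expresses that the plane tree `τ` is the shape of the noncrossing tree
`θ`, the correspondence between the vertices of `τ` and those of `θ` being given by `f`:
`f` is a bijection sending the root of `τ` to the vertex `1` of `θ`, sending parent-child
pairs exactly to edges of `θ`, and the planar (clockwise, starting from the parent) order of
the children of each vertex agrees with their order in `τ`. -/
def IsShape (n : ℕ) (θ : NCTree n) (τ : PlaneTree) (f : List ℕ → Fin n) : Prop :=
  τ.verts.card = n ∧
  Set.BijOn f (↑τ.verts) Set.univ ∧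
  (f ([] : List ℕ)).val = 0 ∧
  (∀ u ∈ τ.verts, u ≠ [] → θ.adj.Adj (f u.dropLast) (f u)) ∧
  (∀ u ∈ τ.verts, ∀ v ∈ τ.verts, θ.adj.Adj (f u) (f v) → u = v.dropLast ∨ v = u.dropLast) ∧
  (∀ u ∈ τ.verts, ∀ i j : ℕ, 1 ≤ i → i < j → u ++ [j] ∈ τ.verts →
    f (u ++ [i]) - f u.dropLast < f (u ++ [j]) - f u.dropLast)

/-- `leftOf z w` : the point `w` lies in the (open) left half-plane bounded by the oriented
line from `z` to the complex number `1`. -/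
def leftOf (z w : ℂ) : Prop := 0 < ((starRingEnd ℂ) (1 - z) * (w - z)).im

/-- The number of children of the vertex of `θ` corresponding to the vertex `u` of its shape
`τ` which lie to the left of it (in the left half-plane bounded by the line joining it to the
complex number `1`). -/
def leftCount (n : ℕ) (θ : NCTree n) (τ : PlaneTree) (f : List ℕ → Fin n) (u : List ℕ) : ℕ :=
  Set.ncard {i : ℕ | u ++ [i] ∈ τ.verts ∧ leftOf (ncPos n (f u)) (ncPos n (f (u ++ [i])))}

/-- The degree of the vertex `v` in the noncrossing tree `θ`. -/
def ncDeg (n : ℕ) (θ : NCTree n) (v : Fin n) : ℕ := Set.ncard {w : Fin n | θ.adj.Adj v w}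

/-- The noncrossing tree `θ` viewed as the compact subset of the closed unit disk given by
the union of its edges. -/
def ncSet (n : ℕ) (θ : NCTree n) : Set ℂ :=
  ⋃ (a : Fin n) (b : Fin n) (_ : θ.adj.Adj a b), segment ℝ (ncPos n a) (ncPos n b)


/-- The weight `Ω^w(θ) = ∏_{u ∈ θ} w(deg u)` of a noncrossing tree. -/
def ncWeight (n : ℕ) (w : ℕ → ℝ) (θ : NCTree n) : ℝ := ∏ v : Fin n, w (ncDeg n θ v)

/-- The modified Bienaymé–Galton–Watson weight of a plane tree: the root reproduces according
to `μ0` and the other vertices according to `μ`. -/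
def bgwModW (μ0 μ : ℕ → ℝ) (τ : PlaneTree) : ℝ :=
  μ0 (τ.kc []) * ∏ u ∈ τ.verts.erase [], μ (τ.kc u)

/-- The total mass `BGW^{μ0,μ}(T_n)` given by the modified Bienaymé–Galton–Watson measure to
plane trees with `n` vertices. -/
def bgwModMass (μ0 μ : ℕ → ℝ) (n : ℕ) : ℝ :=
  ∑ᶠ τ ∈ {τ : PlaneTree | τ.verts.card = n}, bgwModW μ0 μ τ

/-- `P` is a union of connected components of the graph with edge set `E`. -/
def CClosed (E : Finset (ℕ × ℕ)) (P : ℕ → Prop) : Prop := ∀ e ∈ E, (P e.1 ↔ P e.2)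

/-- The graph with edge set `E` connects all the points of `[s,t]`. -/
def CConn (s t : ℕ) (E : Finset (ℕ × ℕ)) : Prop :=
  ∀ P : ℕ → Prop, CClosed E P → ∀ u v, s ≤ u → u ≤ t → s ≤ v → v ≤ t → P u → P v

/-- `E` is the edge set of a noncrossing tree on `[s,t]`. -/
structure IsT (s t : ℕ) (E : Finset (ℕ × ℕ)) : Prop where
  supp : ∀ e ∈ E, s ≤ e.1 ∧ e.1 < e.2 ∧ e.2 ≤ t
  nc : ∀ e ∈ E, ∀ f ∈ E, ¬ (e.1 < f.1 ∧ f.1 < e.2 ∧ e.2 < f.2)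
  conn : CConn s t E
  min : ∀ e ∈ E, ¬ CConn s t (E.erase e)

lemma CConn.of_base {s t : ℕ} {E : Finset (ℕ × ℕ)} (r : ℕ) (hr : s ≤ r) (hr' : r ≤ t)
    (h : ∀ P : ℕ → Prop, CClosed E P → P r → ∀ v, s ≤ v → v ≤ t → P v) : CConn s t E := by
  intro P hP u v hu hu' hv hv' hPu
  by_cases hPr : P r
  · exact h P hP hPr v hv hv'
  · have := h (fun v => ¬ P v) (fun e he => not_congr (hP e he)) hPr u hu hu'
    exact absurd hPu this

lemma CClosed.mono {E F : Finset (ℕ × ℕ)} (h : E ⊆ F) {P : ℕ → Prop} (hP : CClosed F P) :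
    CClosed E P := fun e he => hP e (h he)

lemma CConn.retract {s t s' t' : ℕ} {F F' : Finset (ℕ × ℕ)} (r : ℕ → ℕ) (hs : s ≤ s') (ht : t' ≤ t)
    (hr : ∀ v, s' ≤ v → v ≤ t' → r v = v)
    (hF : ∀ e ∈ F, r e.1 = r e.2 ∨ (e ∈ F' ∧ r e.1 = e.1 ∧ r e.2 = e.2))
    (h : CConn s t F) : CConn s' t' F' := by
  intro P hP u v hu hu' hv hv' hPu
  have := h (fun v => P (r v)) (by
    intro e he
    rcases hF e he with h1 | ⟨h1, h2, h3⟩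
    · simp only [h1]
    · simp only [h2, h3]; exact hP e h1) u v (by omega) (by omega) (by omega) (by omega)
      (by simpa only [hr u hu hu'] using hPu)
  simpa only [hr v hv hv'] using this

/-- Glue three noncrossing trees along the edge `(s,x)`. -/
def glue (s x : ℕ) (E1 E2 E3 : Finset (ℕ × ℕ)) : Finset (ℕ × ℕ) :=
  insert (s, x) (E1 ∪ E2 ∪ E3)

lemma mem_glue {s x : ℕ} {E1 E2 E3 : Finset (ℕ × ℕ)} {e : ℕ × ℕ} :
    e ∈ glue s x E1 E2 E3 ↔ e = (s, x) ∨ e ∈ E1 ∨ e ∈ E2 ∨ e ∈ E3 := by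
  simp [glue, or_assoc]

lemma conn_glue {s p x t : ℕ} {E1 E2 E3 F : Finset (ℕ × ℕ)} (h1 : s ≤ p) (h2 : p < x) (h3 : x ≤ t)
    (c1 : CConn s p E1) (c2 : CConn (p + 1) x E2) (c3 : CConn x t E3)
    (hF : glue s x E1 E2 E3 ⊆ F) : CConn s t F := by
  apply CConn.of_base s le_rfl (by omega)
  intro P hP hs v hv hv'
  replace hP := hP.mono hF
  have hx : P x := (hP (s, x) (by simp [glue])).1 hs
  rcases le_or_gt v p with h | h
  · exact c1 P (fun e he => hP e (mem_glue.2 (by tauto))) s v le_rfl h1 hv h hs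
  rcases le_or_gt v x with h' | h'
  · exact c2 P (fun e he => hP e (mem_glue.2 (by tauto))) x v h2 le_rfl h h' hx
  · exact c3 P (fun e he => hP e (mem_glue.2 (by tauto))) x v le_rfl h3 h'.le hv' hx

lemma isT_glue {s p x t : ℕ} {E1 E2 E3 : Finset (ℕ × ℕ)} (h1 : s ≤ p) (h2 : p < x) (h3 : x ≤ t)
    (T1 : IsT s p E1) (T2 : IsT (p + 1) x E2) (T3 : IsT x t E3) :
    IsT s t (glue s x E1 E2 E3) := by
  refine ⟨?_, ?_, ?_, ?_⟩
  · intro e he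
    rcases mem_glue.1 he with rfl | he | he | he
    · simp; omega
    · have := T1.supp e he; omega
    · have := T2.supp e he; omega
    · have := T3.supp e he; omega
  · intro e he f hf
    rcases mem_glue.1 he with rfl | he | he | he <;> rcases mem_glue.1 hf with rfl | hf | hf | hf
    · simp
    · have := T1.supp f hf; simp; omega
    · have := T2.supp f hf; simp; omega
    · have := T3.supp f hf; simp; omega
    · have := T1.supp e he; simp; omega
    · exact T1.nc e he f hf
    · have := T1.supp e he; have := T2.supp f hf; omega
    · have := T1.supp e he; have := T3.supp f hf; omega
    · have := T2.supp e he; simp; omega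
    · have := T2.supp e he; have := T1.supp f hf; omega
    · exact T2.nc e he f hf
    · have := T2.supp e he; have := T3.supp f hf; omega
    · have := T3.supp e he; simp; omega
    · have := T3.supp e he; have := T1.supp f hf; omega
    · have := T3.supp e he; have := T2.supp f hf; omega
    · exact T3.nc e he f hf
  · exact conn_glue h1 h2 h3 T1.conn T2.conn T3.conn subset_rfl
  · intro e he hc
    rcases mem_glue.1 he with rfl | he | he | he
    · have := hc (fun v => v ≤ p) (by
        intro f hf
        rw [Finset.mem_erase, mem_glue] at hf
        rcases hf with ⟨hf0, hf | hf | hf | hf⟩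
        · exact absurd hf hf0
        · have := T1.supp f hf; omega
        · have := T2.supp f hf; omega
        · have := T3.supp f hf; omega) s x le_rfl (by omega) (by omega) h3 h1
      omega
    · refine T1.min e he (hc.retract (fun v => if v ≤ p then v else s) le_rfl (by omega)
        (fun v _ h => if_pos h) ?_)
      intro f hf
      rw [Finset.mem_erase, mem_glue] at hf
      rcases hf with ⟨hf0, rfl | hf | hf | hf⟩
      · left; simp; omega
      · right; have := T1.supp f hf
        exact ⟨Finset.mem_erase.2 ⟨hf0, hf⟩, if_pos (by omega), if_pos (by omega)⟩
      · left; have := T2.supp f hf; (try dsimp only); rw [if_neg (by omega), if_neg (by omega)]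
      · left; have := T3.supp f hf; (try dsimp only); rw [if_neg (by omega), if_neg (by omega)]
    · refine T2.min e he (hc.retract (fun v => if p < v ∧ v ≤ x then v else x) (by omega) (by omega)
        (fun v h h' => if_pos (by omega)) ?_)
      intro f hf
      rw [Finset.mem_erase, mem_glue] at hf
      rcases hf with ⟨hf0, rfl | hf | hf | hf⟩
      · left; simp; omega
      · left; have := T1.supp f hf; (try dsimp only); split_ifs <;> omega
      · right; have := T2.supp f hf
        exact ⟨Finset.mem_erase.2 ⟨hf0, hf⟩, if_pos (by omega), if_pos (by omega)⟩
      · left; have := T3.supp f hf; (try dsimp only); split_ifs <;> omega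
    · refine T3.min e he (hc.retract (fun v => if x ≤ v then v else x) (by omega) (by omega)
        (fun v h h' => if_pos (by omega)) ?_)
      intro f hf
      rw [Finset.mem_erase, mem_glue] at hf
      rcases hf with ⟨hf0, rfl | hf | hf | hf⟩
      · left; (try dsimp only); split_ifs <;> omega
      · left; have := T1.supp f hf; (try dsimp only); split_ifs <;> omega
      · left; have := T2.supp f hf; (try dsimp only); split_ifs <;> omega
      · right; have := T3.supp f hf
        exact ⟨Finset.mem_erase.2 ⟨hf0, hf⟩, if_pos (by omega), if_pos (by omega)⟩

lemma IsT.decomp {s t : ℕ} {E : Finset (ℕ × ℕ)} (hst : s < t) (T : IsT s t E) :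
    ∃ p x E1 E2 E3, s ≤ p ∧ p < x ∧ x ≤ t ∧ IsT s p E1 ∧ IsT (p + 1) x E2 ∧ IsT x t E3 ∧
      E = glue s x E1 E2 E3 := by
  classical
  -- the largest neighbour of `s`
  have hne : ∃ y, (s, y) ∈ E := by
    by_contra hno
    push Not at hno
    have := T.conn (fun v => v = s) (by
      intro e he
      have := T.supp e he
      have h2 : e.1 ≠ s := by
        rintro h
        exact hno e.2 (by rw [← h]; exact he)
      constructor <;> intro h <;> omega) s t le_rfl hst.le hst.le le_rfl rfl
    omega
  obtain ⟨x, hx, hxmax⟩ : ∃ x, (s, x) ∈ E ∧ ∀ y, (s, y) ∈ E → y ≤ x := by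
    have hS : ∀ y, y ∈ (E.image Prod.snd).filter (fun y => (s, y) ∈ E) ↔ (s, y) ∈ E := by
      intro y
      rw [Finset.mem_filter]
      exact ⟨fun h => h.2, fun h => ⟨Finset.mem_image.2 ⟨(s, y), h, rfl⟩, h⟩⟩
    generalize (E.image Prod.snd).filter (fun y => (s, y) ∈ E) = S at hS
    have hfin : S.Nonempty := by
      obtain ⟨y, hy⟩ := hne
      exact ⟨y, (hS y).2 hy⟩
    exact ⟨S.max' hfin, (hS _).1 (S.max'_mem hfin), fun y hy => S.le_max' y ((hS y).2 hy)⟩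
  have hsx := T.supp _ hx
  simp only at hsx
  set E' := E.erase (s, x) with hE'
  have hE'E : ∀ e ∈ E', e ∈ E := fun e he => Finset.mem_of_mem_erase he
  obtain ⟨R, hRd⟩ : ∃ R : ℕ → Prop, ∀ v, R v ↔ ∀ P : ℕ → Prop, CClosed E' P → P s → P v :=
    ⟨_, fun v => Iff.rfl⟩
  have hRs : R s := (hRd s).2 fun P _ h => h
  have hRc : CClosed E' R := by
    intro e he
    rw [hRd, hRd]
    constructor
    · intro h P hP hPs; exact (hP e he).1 (h P hP hPs)
    · intro h P hP hPs; exact (hP e he).2 (h P hP hPs)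
  have hEcases : ∀ e ∈ E, e = (s, x) ∨ e ∈ E' := by
    intro e he
    by_cases h : e = (s, x)
    · exact Or.inl h
    · exact Or.inr (Finset.mem_erase.2 ⟨h, he⟩)
  have hRx : ¬ R x := by
    intro h
    apply T.min _ hx
    apply CConn.of_base s le_rfl hst.le
    intro P hP hPs v hv hv'
    refine T.conn P ?_ s v le_rfl hst.le hv hv' hPs
    intro e he
    rcases hEcases e he with rfl | he
    · exact ⟨fun _ => (hRd x).1 h P hP hPs, fun _ => hPs⟩
    · exact hP e he
  have hRlt : ∀ v, R v → v < x := by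
    intro v hv
    refine ((hRd v).1 hv (fun u => R u ∧ u < x) ?_ ⟨hRs, hsx.2.1⟩).2
    intro e he
    have hs := T.supp e (hE'E e he)
    have hR := hRc e he
    constructor
    · rintro ⟨h1, h2⟩
      refine ⟨hR.1 h1, ?_⟩
      by_contra hlt
      have h3 : e.2 ≠ x := by intro h; rw [h] at hR; exact hRx (hR.1 h1)
      have h4 := T.nc _ hx e (hE'E e he)
      simp only at h4
      have h5 : e.1 = s := by omega
      have := hxmax e.2 (by rw [← h5]; exact hE'E e he)
      omega
    · rintro ⟨h1, h2⟩
      exact ⟨hR.2 h1, by omega⟩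
  have hdown : ∀ a b, R a → s ≤ b → b < a → R b := by
    intro a b ha hsb hba
    by_contra hb
    obtain ⟨e, he, he1, he2, he3, he4⟩ : ∃ e ∈ E', R e.1 ∧ R e.2 ∧ e.1 < b ∧ b < e.2 := by
      by_contra hno
      push Not at hno
      have hsb' : s < b := by
        rcases hsb.eq_or_lt with h | h
        · rw [← h] at hb; exact absurd hRs hb
        · exact h
      have := ((hRd a).1 ha (fun u => R u ∧ u < b) (by
        intro e he
        have hs := T.supp e (hE'E e he)
        have hR := hRc e he
        constructor
        · rintro ⟨h1, h2⟩
          refine ⟨hR.1 h1, ?_⟩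
          have h3 := hno e he h1 (hR.1 h1) h2
          have h4 : e.2 ≠ b := by intro h; rw [h] at hR; exact hb (hR.1 h1)
          omega
        · rintro ⟨h1, h2⟩
          exact ⟨hR.2 h1, by omega⟩) ⟨hRs, hsb'⟩).2
      omega
    have hq := hRlt _ he2
    have hax := hRlt _ ha
    have := T.conn (fun v => ¬ R v ∧ e.1 < v ∧ v < e.2) (by
      intro f hf
      rcases hEcases f hf with rfl | hf'
      · constructor
        · rintro ⟨h, _⟩; exact absurd hRs h
        · rintro ⟨_, h⟩; simp only at h; omega
      have hs := T.supp f hf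
      have hR := hRc f hf'
      have n1 := T.nc e (hE'E e he) f hf
      have n2 := T.nc f hf e (hE'E e he)
      constructor
      · rintro ⟨h1, h2⟩
        have h3 := (not_congr hR).1 h1
        have h4 : f.2 ≠ e.2 := by intro h; rw [h] at h3; exact h3 he2
        exact ⟨h3, by omega, by omega⟩
      · rintro ⟨h1, h2⟩
        have h3 := (not_congr hR).2 h1
        have h4 : f.1 ≠ e.1 := by intro h; rw [h] at h3; exact h3 he1
        exact ⟨h3, by omega, by omega⟩) b x hsb (by omega) (by omega) (by omega) ⟨hb, he3, he4⟩
    omega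
  obtain ⟨p, hsp, hpx, hRp⟩ : ∃ p, s ≤ p ∧ p < x ∧ ∀ v, s ≤ v → (R v ↔ v ≤ p) := by
    have hex : ∃ v, s ≤ v ∧ ¬ R v := ⟨x, by omega, hRx⟩
    have hf := Nat.find_spec hex
    have hm : ∀ m, m < Nat.find hex → ¬ (s ≤ m ∧ ¬ R m) := fun m hm => Nat.find_min hex hm
    have hle : Nat.find hex ≤ x := Nat.find_min' hex ⟨by omega, hRx⟩
    generalize Nat.find hex = q at hf hm hle
    have hqs : q ≠ s := by rintro rfl; exact hf.2 hRs
    refine ⟨q - 1, by omega, by omega, fun v hv => ⟨fun h => ?_, fun h => ?_⟩⟩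
    · by_contra hlt
      rcases (show q ≤ v by omega).eq_or_lt with h' | h'
      · rw [h'] at hf; exact hf.2 h
      · exact hf.2 (hdown v q h hf.1 h')
    · by_contra hno
      exact hm v (by omega) ⟨hv, hno⟩
  -- classification of the edges
  have hcl : ∀ e ∈ E, e = (s, x) ∨ e.2 ≤ p ∨ (p < e.1 ∧ e.2 ≤ x) ∨ (x ≤ e.1) := by
    intro e he
    rcases hEcases e he with h | he'
    · exact Or.inl h
    right
    have hs := T.supp e he
    have hR := hRc e he'
    rw [hRp _ hs.1, hRp _ (by omega)] at hR
    have h4 := T.nc _ hx e he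
    simp only at h4
    omega
  have hEq : E = glue s x (E.filter (fun e => e.2 ≤ p)) (E.filter (fun e => p < e.1 ∧ e.2 ≤ x))
      (E.filter (fun e => x ≤ e.1)) := by
    ext e
    rw [mem_glue]
    simp only [Finset.mem_filter]
    constructor
    · intro he; have := hcl e he; tauto
    · rintro (rfl | h | h | h)
      · exact hx
      · exact h.1
      · exact h.1
      · exact h.1
  have C1 : CConn s p (E.filter (fun e => e.2 ≤ p)) := by
    refine T.conn.retract (fun v => if v ≤ p then v else s) le_rfl (by omega)
        (fun v _ h => if_pos h) ?_
    intro f hf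
    have hs := T.supp f hf
    rcases hcl f hf with rfl | h | h | h
    · left; simp; omega
    · right; exact ⟨Finset.mem_filter.2 ⟨hf, h⟩, if_pos (by omega), if_pos (by omega)⟩
    · left; (try dsimp only); rw [if_neg (by omega), if_neg (by omega)]
    · left; (try dsimp only); rw [if_neg (by omega), if_neg (by omega)]
  have C2 : CConn (p + 1) x (E.filter (fun e => p < e.1 ∧ e.2 ≤ x)) := by
    refine T.conn.retract (fun v => if p < v ∧ v ≤ x then v else x) (by omega) (by omega)
        (fun v h h' => if_pos (by omega)) ?_
    intro f hf
    have hs := T.supp f hf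
    rcases hcl f hf with rfl | h | h | h
    · left; simp; omega
    · left; (try dsimp only); split_ifs <;> omega
    · right; exact ⟨Finset.mem_filter.2 ⟨hf, h⟩, if_pos (by omega), if_pos (by omega)⟩
    · left; (try dsimp only); split_ifs <;> omega
  have C3 : CConn x t (E.filter (fun e => x ≤ e.1)) := by
    refine T.conn.retract (fun v => if x ≤ v then v else x) (by omega) (by omega)
        (fun v h h' => if_pos (by omega)) ?_
    intro f hf
    have hs := T.supp f hf
    rcases hcl f hf with rfl | h | h | h
    · left; (try dsimp only); split_ifs <;> omega
    · left; (try dsimp only); split_ifs <;> omega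
    · left; (try dsimp only); split_ifs <;> omega
    · right; exact ⟨Finset.mem_filter.2 ⟨hf, h⟩, if_pos (by omega), if_pos (by omega)⟩
  have key : ∀ e F1 F2 F3, CConn s p F1 → CConn (p + 1) x F2 → CConn x t F3 → e ∈ E →
      e ∉ F1 → e ∉ F2 → e ∉ F3 → e ≠ (s, x) → F1 ⊆ E → F2 ⊆ E → F3 ⊆ E → False := by
    intro e F1 F2 F3 c1 c2 c3 he n1 n2 n3 n4 s1 s2 s3
    refine T.min e he (conn_glue hsp hpx hsx.2.2 c1 c2 c3 ?_)
    intro f hf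
    rw [Finset.mem_erase]
    rcases mem_glue.1 hf with rfl | h | h | h
    · exact ⟨n4.symm, hx⟩
    · exact ⟨fun h' => n1 (h' ▸ h), s1 h⟩
    · exact ⟨fun h' => n2 (h' ▸ h), s2 h⟩
    · exact ⟨fun h' => n3 (h' ▸ h), s3 h⟩
  refine ⟨p, x, _, _, _, hsp, hpx, hsx.2.2, ⟨?_, ?_, C1, ?_⟩, ⟨?_, ?_, C2, ?_⟩, ⟨?_, ?_, C3, ?_⟩, hEq⟩
  · intro e he; rw [Finset.mem_filter] at he; have := T.supp e he.1; omega
  · intro e he f hf; exact T.nc e (Finset.mem_filter.1 he).1 f (Finset.mem_filter.1 hf).1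
  · intro e he hc
    have he' := Finset.mem_filter.1 he
    have := T.supp e he'.1
    refine key e _ _ _ hc C2 C3 he'.1 (by simp) ?_ ?_ ?_ ((Finset.erase_subset _ _).trans
      (Finset.filter_subset _ _)) (Finset.filter_subset _ _) (Finset.filter_subset _ _)
    · simp only [Finset.mem_filter]; omega
    · simp only [Finset.mem_filter]; omega
    · rintro rfl; simp only at *; omega
  · intro e he; rw [Finset.mem_filter] at he; have := T.supp e he.1; omega
  · intro e he f hf; exact T.nc e (Finset.mem_filter.1 he).1 f (Finset.mem_filter.1 hf).1
  · intro e he hc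
    have he' := Finset.mem_filter.1 he
    have := T.supp e he'.1
    refine key e _ _ _ C1 hc C3 he'.1 ?_ (by simp) ?_ ?_ (Finset.filter_subset _ _)
      ((Finset.erase_subset _ _).trans (Finset.filter_subset _ _)) (Finset.filter_subset _ _)
    · simp only [Finset.mem_filter]; omega
    · simp only [Finset.mem_filter]; omega
    · rintro rfl; simp only at *; omega
  · intro e he; rw [Finset.mem_filter] at he; have := T.supp e he.1; omega
  · intro e he f hf; exact T.nc e (Finset.mem_filter.1 he).1 f (Finset.mem_filter.1 hf).1
  · intro e he hc
    have he' := Finset.mem_filter.1 he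
    have := T.supp e he'.1
    refine key e _ _ _ C1 C2 hc he'.1 ?_ ?_ (by simp) ?_ (Finset.filter_subset _ _)
      (Finset.filter_subset _ _) ((Finset.erase_subset _ _).trans (Finset.filter_subset _ _))
    · simp only [Finset.mem_filter]; omega
    · simp only [Finset.mem_filter]; omega
    · rintro rfl; simp only at *; omega

lemma glue_parts {s p x t : ℕ} {E1 E2 E3 : Finset (ℕ × ℕ)} (h1 : s ≤ p) (h2 : p < x) 
    (T1 : IsT s p E1) (T2 : IsT (p + 1) x E2) (T3 : IsT x t E3) :
    E1 = (glue s x E1 E2 E3).filter (fun e => e.2 ≤ p) ∧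
    E2 = (glue s x E1 E2 E3).filter (fun e => p < e.1 ∧ e.2 ≤ x) ∧
    E3 = (glue s x E1 E2 E3).filter (fun e => x ≤ e.1) := by
  refine ⟨?_, ?_, ?_⟩ <;> ext e <;> rw [Finset.mem_filter, mem_glue] <;> constructor
  · intro h; have := T1.supp e h; exact ⟨by tauto, by omega⟩
  · rintro ⟨rfl | h | h | h, h'⟩
    · simp only at h'; omega
    · exact h
    · have := T2.supp e h; omega
    · have := T3.supp e h; omega
  · intro h; have := T2.supp e h; exact ⟨by tauto, by omega⟩
  · rintro ⟨rfl | h | h | h, h'⟩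
    · simp only at h'; omega
    · have := T1.supp e h; omega
    · exact h
    · have := T3.supp e h; omega
  · intro h; have := T3.supp e h; exact ⟨by tauto, by omega⟩
  · rintro ⟨rfl | h | h | h, h'⟩
    · simp only at h'; omega
    · have := T1.supp e h; omega
    · have := T2.supp e h; omega
    · exact h

lemma glue_x_le {s p x t x' p' : ℕ} {E1 E2 E3 F1 F2 F3 : Finset (ℕ × ℕ)} (h1 : s ≤ p) (h2 : p < x)
    (T1 : IsT s p E1) (T2 : IsT (p + 1) x E2) (T3 : IsT x t E3)
    (h1' : s ≤ p') (h2' : p' < x')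
    (h : glue s x' F1 F2 F3 = glue s x E1 E2 E3) : x' ≤ x := by
  have : (s, x') ∈ glue s x E1 E2 E3 := by rw [← h]; simp [glue]
  rcases mem_glue.1 this with h | h | h | h
  · simp only [Prod.mk.injEq] at h; omega
  · have := T1.supp _ h; simp only at this; omega
  · have := T2.supp _ h; simp only at this; omega
  · have := T3.supp _ h; simp only at this; omega

lemma glue_p_le {s p x t p' : ℕ} {E1 E2 E3 F1 F2 F3 : Finset (ℕ × ℕ)} (h1 : s ≤ p) (h2 : p < x)
    (T1 : IsT s p E1) (T2 : IsT (p + 1) x E2) (T3 : IsT x t E3)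
    (h1' : s ≤ p') (h2' : p' < x) (T1' : IsT s p' F1)
    (h : glue s x F1 F2 F3 = glue s x E1 E2 E3) : p' ≤ p := by
  refine T1'.conn (fun v => v ≤ p) ?_ s p' le_rfl h1' h1' le_rfl h1
  intro e he
  have : e ∈ glue s x E1 E2 E3 := by rw [← h, mem_glue]; tauto
  have hs := T1'.supp e he
  rcases mem_glue.1 this with rfl | h | h | h
  · simp only at hs; omega
  · have := T1.supp _ h; omega
  · have := T2.supp _ h; omega
  · have := T3.supp _ h; omega

/-- Degree of a vertex. -/
def dg (E : Finset (ℕ × ℕ)) (v : ℕ) : ℕ := (E.filter (fun e => e.1 = v ∨ e.2 = v)).card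

lemma dg_glue {s p x t : ℕ} {E1 E2 E3 : Finset (ℕ × ℕ)} (h1 : s ≤ p) (h2 : p < x)
    (T1 : IsT s p E1) (T2 : IsT (p + 1) x E2) (T3 : IsT x t E3) (v : ℕ) :
    dg (glue s x E1 E2 E3) v = (if v = s ∨ v = x then 1 else 0) + dg E1 v + dg E2 v + dg E3 v := by
  have d12 : Disjoint E1 E2 := Finset.disjoint_left.2 fun e h h' => by
    have := T1.supp e h; have := T2.supp e h'; omega
  have d13 : Disjoint (E1 ∪ E2) E3 := Finset.disjoint_left.2 fun e h h' => by
    have := T3.supp e h'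
    rcases Finset.mem_union.1 h with h | h
    · have := T1.supp e h; omega
    · have := T2.supp e h; omega
  have d0 : (s, x) ∉ E1 ∪ E2 ∪ E3 := by
    simp only [Finset.mem_union]
    rintro ((h | h) | h)
    · have := T1.supp _ h; simp only at this; omega
    · have := T2.supp _ h; simp only at this; omega
    · have := T3.supp _ h; simp only at this; omega
  unfold dg glue
  rw [Finset.card_filter, Finset.sum_insert d0, Finset.sum_union d13, Finset.sum_union d12,
    Finset.card_filter, Finset.card_filter, Finset.card_filter]
  simp only [eq_comm (a := v)]
  ring

lemma dg_eq_zero {s t : ℕ} {E : Finset (ℕ × ℕ)} (T : IsT s t E) {v : ℕ} (hv : v < s ∨ t < v) :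
    dg E v = 0 := by
  unfold dg
  rw [Finset.card_eq_zero, Finset.filter_eq_empty_iff]
  intro e he
  have := T.supp e he
  omega


open Classical in
/-- The finset of noncrossing trees on `[s,t]`. -/
def ncTrees (s t : ℕ) : Finset (Finset (ℕ × ℕ)) :=
  ((Finset.Icc s t ×ˢ Finset.Icc s t).powerset).filter (IsT s t)

lemma mem_ncTrees {s t : ℕ} {E : Finset (ℕ × ℕ)} : E ∈ ncTrees s t ↔ IsT s t E := by
  classical
  unfold ncTrees
  rw [Finset.mem_filter, Finset.mem_powerset]
  refine ⟨fun h => h.2, fun h => ⟨fun e he => ?_, h⟩⟩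
  have := h.supp e he
  rw [Finset.mem_product, Finset.mem_Icc, Finset.mem_Icc]
  omega

/-- Generating sum of trees rooted at the left end. -/
def NL (w : ℕ → ℝ) (s t : ℕ) (f : ℕ → ℝ) : ℝ :=
  ∑ E ∈ ncTrees s t, f (dg E s) * ∏ v ∈ Finset.Ioc s t, w (dg E v)

/-- Generating sum of trees rooted at the right end. -/
def NR (w : ℕ → ℝ) (s t : ℕ) (f : ℕ → ℝ) : ℝ :=
  ∑ E ∈ ncTrees s t, f (dg E t) * ∏ v ∈ Finset.Ico s t, w (dg E v)

lemma NL_self (w : ℕ → ℝ) (s : ℕ) (f : ℕ → ℝ) : NL w s s f = f 0 := by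
  have : ncTrees s s = {∅} := by
    ext E
    rw [mem_ncTrees, Finset.mem_singleton]
    constructor
    · intro h
      refine Finset.eq_empty_of_forall_notMem fun e he => ?_
      have := h.supp e he
      omega
    · rintro rfl
      refine ⟨by simp, by simp, ?_, by simp⟩
      intro P _ u v h1 h2 h3 h4 h
      have : u = v := by omega
      exact this ▸ h
  unfold NL
  rw [this]
  simp [dg]

/-- Reflection of an edge set. -/
def refl' (c : ℕ) (E : Finset (ℕ × ℕ)) : Finset (ℕ × ℕ) := E.image (fun e => (c - e.2, c - e.1))

lemma refl'_refl' {s t : ℕ} {E : Finset (ℕ × ℕ)}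
    (h : ∀ e ∈ E, s ≤ e.1 ∧ e.1 < e.2 ∧ e.2 ≤ t) : refl' (s + t) (refl' (s + t) E) = E := by
  unfold refl'
  rw [Finset.image_image]
  conv_rhs => rw [← Finset.image_id (s := E)]
  apply Finset.image_congr
  intro e he
  have := h e he
  simp only [Function.comp, id]
  ext <;> simp only <;> omega

lemma refl'_inj {s t : ℕ} {e f : ℕ × ℕ} (h : s ≤ e.1 ∧ e.1 < e.2 ∧ e.2 ≤ t)
    (h' : s ≤ f.1 ∧ f.1 < f.2 ∧ f.2 ≤ t)
    (heq : (s + t - e.2, s + t - e.1) = (s + t - f.2, s + t - f.1)) : e = f := by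
  simp only [Prod.mk.injEq] at heq
  ext <;> omega

lemma conn_refl' {s t : ℕ} {E F : Finset (ℕ × ℕ)}
    (hE : ∀ e ∈ E, (s + t - e.2, s + t - e.1) ∈ F) (h : CConn s t E) :
    CConn s t F := by
  intro P hP u v hu hu' hv hv' hPu
  have := h (fun v => P (s + t - v)) (by
    intro e he
    exact (hP _ (hE e he)).symm) (s + t - u) (s + t - v) (by omega) (by omega) (by omega)
    (by omega) (by have : s + t - (s + t - u) = u := by omega
                   simpa only [this] using hPu)
  have h2 : s + t - (s + t - v) = v := by omega
  simpa only [h2] using this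

lemma IsT.refl' {s t : ℕ} {E : Finset (ℕ × ℕ)} (T : IsT s t E) : IsT s t (refl' (s + t) E) := by
  refine ⟨?_, ?_, ?_, ?_⟩
  · intro e he
    obtain ⟨f, hf, rfl⟩ := Finset.mem_image.1 he
    have := T.supp f hf
    simp only
    omega
  · intro e he e' he'
    obtain ⟨f, hf, rfl⟩ := Finset.mem_image.1 he
    obtain ⟨f', hf', rfl⟩ := Finset.mem_image.1 he'
    have := T.supp f hf
    have := T.supp f' hf'
    have := T.nc f' hf' f hf
    simp only
    omega
  · exact conn_refl' (fun e he => Finset.mem_image.2 ⟨e, he, rfl⟩) T.conn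
  · intro e he hc
    obtain ⟨f, hf, rfl⟩ := Finset.mem_image.1 he
    have hsf := T.supp f hf
    refine T.min f hf (conn_refl' ?_ hc)
    intro e' he'
    rw [Finset.mem_erase] at he'
    obtain ⟨hne, he'⟩ := he'
    obtain ⟨g, hg, rfl⟩ := Finset.mem_image.1 he'
    have hs := T.supp g hg
    have : (s + t - (s + t - g.2, s + t - g.1).2, s + t - (s + t - g.2, s + t - g.1).1) = g := by
      ext <;> simp only <;> omega
    rw [this, Finset.mem_erase]
    exact ⟨fun h => hne (by rw [h]), hg⟩

lemma dg_refl' {s t : ℕ} {E : Finset (ℕ × ℕ)} (T : IsT s t E) (v : ℕ) (_hv : s ≤ v) (hv' : v ≤ t) :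
    dg (refl' (s + t) E) v = dg E (s + t - v) := by
  unfold dg _root_.refl'
  rw [Finset.filter_image, Finset.card_image_of_injOn]
  · congr 1
    apply Finset.filter_congr
    intro e he
    have := T.supp e he
    simp only
    omega
  · intro e he f hf h
    simp only [Finset.coe_filter, Set.mem_ofPred_eq] at he hf
    exact refl'_inj (T.supp e he.1) (T.supp f hf.1) h

lemma NR_eq_NL (w : ℕ → ℝ) (s t : ℕ) (hst : s ≤ t) (f : ℕ → ℝ) : NR w s t f = NL w s t f := by
  unfold NR NL
  refine Finset.sum_nbij' (refl' (s + t)) (refl' (s + t)) ?_ ?_ ?_ ?_ ?_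
  · intro E hE; exact mem_ncTrees.2 (mem_ncTrees.1 hE).refl'
  · intro E hE; exact mem_ncTrees.2 (mem_ncTrees.1 hE).refl'
  · intro E hE; exact refl'_refl' (mem_ncTrees.1 hE).supp
  · intro E hE; exact refl'_refl' (mem_ncTrees.1 hE).supp
  · intro E hE
    have T := mem_ncTrees.1 hE
    rw [dg_refl' T s le_rfl hst, Nat.add_sub_cancel_left]
    congr 1
    refine Finset.prod_nbij' (fun v => s + t - v) (fun v => s + t - v) ?_ ?_ ?_ ?_ ?_
    · intro v hv; simp only [Finset.mem_Ioc, Finset.mem_Ico] at *; omega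
    · intro v hv; simp only [Finset.mem_Ioc, Finset.mem_Ico] at *; omega
    · intro v hv; simp only [Finset.mem_Ioc, Finset.mem_Ico] at *; omega
    · intro v hv; simp only [Finset.mem_Ioc, Finset.mem_Ico] at *; omega
    · intro v hv
      simp only [Finset.mem_Ioc, Finset.mem_Ico] at *
      rw [dg_refl' T _ (by omega) (by omega)]
      congr 2
      omega

lemma glue_weight (w f : ℕ → ℝ) {s p x t : ℕ} {E1 E2 E3 : Finset (ℕ × ℕ)} (h1 : s ≤ p) (h2 : p < x)
    (h3 : x ≤ t) (T1 : IsT s p E1) (T2 : IsT (p + 1) x E2) (T3 : IsT x t E3) :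
    f (dg (glue s x E1 E2 E3) s) * ∏ v ∈ Finset.Ioc s t, w (dg (glue s x E1 E2 E3) v) =
      (f (dg E1 s + 1) * ∏ v ∈ Finset.Ioc s p, w (dg E1 v)) *
      ((w (dg E2 x + dg E3 x + 1) * ∏ v ∈ Finset.Ioc x t, w (dg E3 v)) *
        ∏ v ∈ Finset.Ico (p + 1) x, w (dg E2 v)) := by
  have hd := dg_glue h1 h2 T1 T2 T3
  have e1 : dg (glue s x E1 E2 E3) s = dg E1 s + 1 := by
    rw [hd, dg_eq_zero T2 (by omega), dg_eq_zero T3 (by omega)]; simp; omega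
  have e2 : dg (glue s x E1 E2 E3) x = dg E2 x + dg E3 x + 1 := by
    rw [hd, dg_eq_zero T1 (by omega)]; simp; omega
  have hsplit : Finset.Ioc s t = Finset.Ioc s p ∪ (Finset.Ico (p + 1) x ∪ ({x} ∪ Finset.Ioc x t)) := by
    ext v; simp only [Finset.mem_Ioc, Finset.mem_Ico, Finset.mem_union, Finset.mem_singleton]; omega
  have d1 : Disjoint (Finset.Ioc s p) (Finset.Ico (p + 1) x ∪ ({x} ∪ Finset.Ioc x t)) := by
    rw [Finset.disjoint_left]
    intro v; simp only [Finset.mem_Ioc, Finset.mem_Ico, Finset.mem_union, Finset.mem_singleton]; omega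
  have d2 : Disjoint (Finset.Ico (p + 1) x) ({x} ∪ Finset.Ioc x t) := by
    rw [Finset.disjoint_left]
    intro v; simp only [Finset.mem_Ioc, Finset.mem_Ico, Finset.mem_union, Finset.mem_singleton]; omega
  have d3 : Disjoint ({x} : Finset ℕ) (Finset.Ioc x t) := by
    rw [Finset.disjoint_left]
    intro v; simp only [Finset.mem_Ioc, Finset.mem_singleton]; omega
  rw [hsplit, Finset.prod_union d1, Finset.prod_union d2, Finset.prod_union d3,
    Finset.prod_singleton, e1, e2]
  have p1 : ∏ v ∈ Finset.Ioc s p, w (dg (glue s x E1 E2 E3) v) = ∏ v ∈ Finset.Ioc s p, w (dg E1 v) := by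
    refine Finset.prod_congr rfl fun v hv => ?_
    rw [Finset.mem_Ioc] at hv
    rw [hd, dg_eq_zero T2 (by omega), dg_eq_zero T3 (by omega), if_neg (by omega)]; simp
  have p2 : ∏ v ∈ Finset.Ico (p + 1) x, w (dg (glue s x E1 E2 E3) v)
      = ∏ v ∈ Finset.Ico (p + 1) x, w (dg E2 v) := by
    refine Finset.prod_congr rfl fun v hv => ?_
    rw [Finset.mem_Ico] at hv
    rw [hd, dg_eq_zero T1 (by omega), dg_eq_zero T3 (by omega), if_neg (by omega)]; simp
  have p3 : ∏ v ∈ Finset.Ioc x t, w (dg (glue s x E1 E2 E3) v) = ∏ v ∈ Finset.Ioc x t, w (dg E3 v) := by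
    refine Finset.prod_congr rfl fun v hv => ?_
    rw [Finset.mem_Ioc] at hv
    rw [hd, dg_eq_zero T1 (by omega), dg_eq_zero T2 (by omega), if_neg (by omega)]; simp
  rw [p1, p2, p3]
  ring

lemma NL_rec (w : ℕ → ℝ) {s t : ℕ} (hst : s < t) (f : ℕ → ℝ) :
    NL w s t f = ∑ p ∈ Finset.Ico s t, ∑ x ∈ Finset.Ioc p t,
      NL w s p (fun k => f (k + 1)) *
        NR w (p + 1) x (fun i => NL w x t (fun j => w (i + j + 1))) := by
  have : ∀ p x, NL w s p (fun k => f (k + 1)) *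
        NR w (p + 1) x (fun i => NL w x t (fun j => w (i + j + 1))) =
      ∑ q ∈ ncTrees s p ×ˢ (ncTrees (p + 1) x ×ˢ ncTrees x t),
        ((f (dg q.1 s + 1) * ∏ v ∈ Finset.Ioc s p, w (dg q.1 v)) *
      ((w (dg q.2.1 x + dg q.2.2 x + 1) * ∏ v ∈ Finset.Ioc x t, w (dg q.2.2 v)) *
        ∏ v ∈ Finset.Ico (p + 1) x, w (dg q.2.1 v))) := by
    intro p x
    rw [Finset.sum_product]
    unfold NL NR
    rw [Finset.sum_mul]
    refine Finset.sum_congr rfl fun E1 _ => ?_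
    rw [Finset.sum_product, Finset.mul_sum]
    refine Finset.sum_congr rfl fun E2 _ => ?_
    rw [Finset.sum_mul, Finset.mul_sum]
  simp only [this]
  rw [Finset.sum_sigma', Finset.sum_sigma']
  symm
  unfold NL
  refine Finset.sum_bij (fun q _ => glue s q.1.2 q.2.1 q.2.2.1 q.2.2.2) ?_ ?_ ?_ ?_
  · rintro ⟨⟨p, x⟩, E1, E2, E3⟩ h
    simp only [Finset.mem_sigma, Finset.mem_Ico, Finset.mem_Ioc, Finset.mem_product,
      mem_ncTrees] at h ⊢
    exact isT_glue h.1.1.1 h.1.2.1 h.1.2.2 h.2.1 h.2.2.1 h.2.2.2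
  · rintro ⟨⟨p, x⟩, E1, E2, E3⟩ h ⟨⟨p', x'⟩, F1, F2, F3⟩ h' heq
    simp only [Finset.mem_sigma, Finset.mem_Ico, Finset.mem_Ioc, Finset.mem_product,
      mem_ncTrees] at h h' heq
    obtain ⟨⟨⟨h1, _⟩, h2, h3⟩, T1, T2, T3⟩ := h
    obtain ⟨⟨⟨h1', _⟩, h2', h3'⟩, T1', T2', T3'⟩ := h'
    have hx : x = x' := le_antisymm (glue_x_le h1' h2' T1' T2' T3' h1 h2 heq)
      (glue_x_le h1 h2 T1 T2 T3 h1' h2' heq.symm)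
    subst hx
    have hp : p = p' := le_antisymm (glue_p_le h1' h2' T1' T2' T3' h1 h2 T1 heq)
      (glue_p_le h1 h2 T1 T2 T3 h1' h2' T1' heq.symm)
    subst hp
    obtain ⟨a1, a2, a3⟩ := glue_parts h1 h2 T1 T2 T3
    obtain ⟨b1, b2, b3⟩ := glue_parts h1' h2' T1' T2' T3'
    rw [heq] at a1 a2 a3
    rw [← b1] at a1
    rw [← b2] at a2
    rw [← b3] at a3
    subst a1 a2 a3
    rfl
  · intro E hE
    obtain ⟨p, x, E1, E2, E3, h1, h2, h3, T1, T2, T3, rfl⟩ := (mem_ncTrees.1 hE).decomp hst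
    refine ⟨⟨⟨p, x⟩, E1, E2, E3⟩, ?_, rfl⟩
    simp only [Finset.mem_sigma, Finset.mem_Ico, Finset.mem_Ioc, Finset.mem_product,
      mem_ncTrees]
    exact ⟨⟨⟨h1, by omega⟩, h2, h3⟩, T1, T2, T3⟩
  · rintro ⟨⟨p, x⟩, E1, E2, E3⟩ h
    simp only [Finset.mem_sigma, Finset.mem_Ico, Finset.mem_Ioc, Finset.mem_product,
      mem_ncTrees] at h ⊢
    exact (glue_weight w f h.1.1.1 h.1.2.1 h.1.2.2 h.2.1 h.2.2.1 h.2.2.2).symm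

/-! Plane trees encoded as binary trees. -/

/-- Root degree. -/
def rdT : BinaryTree Unit → ℕ
  | .nil => 0
  | .node _ a _ => rdT a + 1

/-- Product of the weights of the non-root vertices. -/
def wT (m : ℕ → ℝ) : BinaryTree Unit → ℝ
  | .nil => 1
  | .node _ a b => wT m a * (wT m b * m (rdT b))

def PS (m : ℕ → ℝ) (n : ℕ) (f : ℕ → ℝ) : ℝ :=
  ∑ T ∈ BinaryTree.treesOfNumNodesEq n, wT m T * f (rdT T)

lemma PS_zero (m f : ℕ → ℝ) : PS m 0 f = f 0 := by simp [PS, wT, rdT]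

lemma PS_succ (m : ℕ → ℝ) (n : ℕ) (f : ℕ → ℝ) : PS m (n + 1) f =
    ∑ q ∈ Finset.HasAntidiagonal.antidiagonal n, PS m q.1 (fun k => f (k + 1)) * PS m q.2 m := by
  unfold PS
  rw [BinaryTree.treesOfNumNodesEq_succ, Finset.sum_biUnion]
  · refine Finset.sum_congr rfl fun q _ => ?_
    rw [Finset.sum_mul_sum, ← Finset.sum_product']
    unfold BinaryTree.pairwiseNode
    rw [Finset.sum_map]
    refine Finset.sum_congr rfl fun r _ => ?_
    change wT m r.1 * (wT m r.2 * m (rdT r.2)) * f (rdT r.1 + 1) = _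
    ring
  · intro q _ q' _ hne
    simp only [Function.onFun]
    rw [Finset.disjoint_left]
    intro T h h'
    apply hne
    simp only [BinaryTree.pairwiseNode, Finset.mem_map, Finset.mem_product,
      BinaryTree.mem_treesOfNumNodesEq] at h h'
    obtain ⟨⟨a, b⟩, ⟨h1, h2⟩, h3⟩ := h
    obtain ⟨⟨a', b'⟩, ⟨h1', h2'⟩, h3'⟩ := h'
    rw [← h3'] at h3
    simp at h3
    obtain ⟨rfl, rfl⟩ := h3
    ext
    · exact h1.symm.trans h1'
    · exact h2.symm.trans h2'

lemma PS_add (m : ℕ → ℝ) (n : ℕ) (f g : ℕ → ℝ) :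
    PS m n f + PS m n g = PS m n (fun d => f d + g d) := by
  unfold PS
  rw [← Finset.sum_add_distrib]
  exact Finset.sum_congr rfl fun _ _ => by ring

lemma PS_sum_mul {ι : Type*} (A : Finset ι) (m : ℕ → ℝ) (n : ℕ) (f : ι → ℕ → ℝ) (c : ι → ℝ) :
    PS m n (fun i => ∑ q ∈ A, f q i * c q) = ∑ q ∈ A, PS m n (f q) * c q := by
  unfold PS
  simp only [Finset.mul_sum, Finset.sum_mul]
  rw [Finset.sum_comm]
  exact Finset.sum_congr rfl fun _ _ => Finset.sum_congr rfl fun _ _ => by ring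

lemma triple_comm (n : ℕ) (F : ℕ → ℕ → ℕ → ℝ) :
    ∑ q ∈ Finset.HasAntidiagonal.antidiagonal n, ∑ r ∈ Finset.HasAntidiagonal.antidiagonal q.2, F q.1 r.1 r.2 =
    ∑ q ∈ Finset.HasAntidiagonal.antidiagonal n, ∑ r ∈ Finset.HasAntidiagonal.antidiagonal q.1, F r.1 r.2 q.2 := by
  rw [Finset.sum_sigma', Finset.sum_sigma']
  refine Finset.sum_nbij' (fun z => ⟨(z.1.1 + z.2.1, z.2.2), (z.1.1, z.2.1)⟩)
    (fun z => ⟨(z.2.1, z.2.2 + z.1.2), (z.2.2, z.1.2)⟩) ?_ ?_ ?_ ?_ ?_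
  · rintro ⟨⟨a, b⟩, c, d⟩ h
    simp only [Finset.mem_sigma, Finset.HasAntidiagonal.mem_antidiagonal] at *
    obtain ⟨h1, h2⟩ := h
    subst h1
    constructor <;> first | trivial | omega
  · rintro ⟨⟨a, b⟩, c, d⟩ h
    simp only [Finset.mem_sigma, Finset.HasAntidiagonal.mem_antidiagonal] at *
    obtain ⟨h1, h2⟩ := h
    subst h1
    constructor <;> first | trivial | omega
  · rintro ⟨⟨a, b⟩, c, d⟩ h
    simp only [Finset.mem_sigma, Finset.HasAntidiagonal.mem_antidiagonal] at *
    rw [h.2]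
  · rintro ⟨⟨a, b⟩, c, d⟩ h
    simp only [Finset.mem_sigma, Finset.HasAntidiagonal.mem_antidiagonal] at *
    rw [h.2]
  · rintro ⟨⟨a, b⟩, c, d⟩ h
    rfl

lemma PS_conv (m : ℕ → ℝ) (n : ℕ) : ∀ g : ℕ → ℝ,
    ∑ q ∈ Finset.HasAntidiagonal.antidiagonal n, PS m q.1 (fun i => PS m q.2 (fun j => g (i + j))) =
      PS m n (fun d => ((d : ℝ) + 1) * g d) := by
  induction n using Nat.strong_induction_on with
  | _ n ih =>
  intro g
  cases n with
  | zero => simp [PS_zero]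
  | succ n =>
    rw [Finset.Nat.antidiagonal_succ']
    simp only [Finset.sum_cons, Finset.sum_map, Function.Embedding.prodMap,
      Function.Embedding.coeFn_mk, Prod.map, PS_zero, PS_succ, Function.Embedding.refl_apply,
      Nat.succ_eq_add_one]
    have h1 : ∑ q ∈ Finset.HasAntidiagonal.antidiagonal n, PS m q.1 (fun i =>
        ∑ r ∈ Finset.HasAntidiagonal.antidiagonal q.2, PS m r.1 (fun k => g (i + (k + 1))) * PS m r.2 m) =
        ∑ q ∈ Finset.HasAntidiagonal.antidiagonal n, PS m q.1 (fun k => ((k : ℝ) + 1) * g (k + 1)) * PS m q.2 m := by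
      simp only [PS_sum_mul]
      rw [triple_comm n
        (fun a b c => PS m a (fun i => PS m b (fun k => g (i + (k + 1)))) * PS m c m)]
      refine Finset.sum_congr rfl fun q hq => ?_
      rw [Finset.HasAntidiagonal.mem_antidiagonal] at hq
      have := ih q.1 (by omega) (fun d => g (d + 1))
      rw [← this, Finset.sum_mul]
      rfl
    erw [h1]
    simp only [add_zero]
    rw [← Finset.sum_add_distrib]
    refine Finset.sum_congr rfl fun q _ => ?_
    rw [← add_mul, PS_add]
    congr 2
    funext d
    push_cast
    ring

lemma NL_eq_PS (w : ℕ → ℝ) (d : ℕ) : ∀ s f, NL w s (s + d) f =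
    PS (fun k => ((k : ℝ) + 1) * w (k + 1)) d f := by
  induction d using Nat.strong_induction_on with
  | _ d ih =>
  intro s f
  cases d with
  | zero => rw [add_zero, NL_self, PS_zero]
  | succ d =>
    rw [NL_rec w (by omega), PS_succ]
    have hin : ∀ p ∈ Finset.Ico s (s + (d + 1)), ∑ x ∈ Finset.Ioc p (s + (d + 1)),
      NL w s p (fun k => f (k + 1)) *
        NR w (p + 1) x (fun i => NL w x (s + (d + 1)) (fun j => w (i + j + 1))) =
      PS (fun k => ((k : ℝ) + 1) * w (k + 1)) (p - s) (fun k => f (k + 1)) *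
        PS (fun k => ((k : ℝ) + 1) * w (k + 1)) (d - (p - s)) (fun k => ((k : ℝ) + 1) * w (k + 1)) := by
      intro p hp
      rw [Finset.mem_Ico] at hp
      rw [← Finset.mul_sum]
      congr 1
      · have := ih (p - s) (by omega) s (fun k => f (k + 1))
        rwa [show s + (p - s) = p by omega] at this
      · rw [← PS_conv _ _ (fun k => w (k + 1))]
        refine Finset.sum_nbij' (fun x => (x - (p + 1), s + (d + 1) - x)) (fun q => p + 1 + q.1)
          ?_ ?_ ?_ ?_ ?_
        · intro x hx; simp only [Finset.mem_Ioc, Finset.HasAntidiagonal.mem_antidiagonal] at *; omega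
        · intro x hx; simp only [Finset.mem_Ioc, Finset.HasAntidiagonal.mem_antidiagonal] at *; omega
        · intro x hx; simp only [Finset.mem_Ioc] at *; omega
        · intro x hx; simp only [Finset.HasAntidiagonal.mem_antidiagonal] at *; ext <;> simp only <;> omega
        · intro x hx
          rw [Finset.mem_Ioc] at hx
          rw [NR_eq_NL _ _ _ (by omega)]
          have h1 := ih (x - (p + 1)) (by omega) (p + 1)
          rw [show p + 1 + (x - (p + 1)) = x by omega] at h1
          have h2 := ih (s + (d + 1) - x) (by omega) x
          rw [show x + (s + (d + 1) - x) = s + (d + 1) by omega] at h2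
          rw [h1]
          simp only [h2]
    rw [Finset.sum_congr rfl hin]
    refine Finset.sum_nbij' (fun p => (p - s, d - (p - s))) (fun q => s + q.1) ?_ ?_ ?_ ?_ ?_
    · intro x hx; simp only [Finset.mem_Ico, Finset.HasAntidiagonal.mem_antidiagonal] at *; omega
    · intro x hx; simp only [Finset.mem_Ico, Finset.HasAntidiagonal.mem_antidiagonal] at *; omega
    · intro x hx; simp only [Finset.mem_Ico] at *; omega
    · intro x hx; simp only [Finset.HasAntidiagonal.mem_antidiagonal] at *; ext <;> simp only <;> omega
    · intro x hx; rfl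


namespace PlaneTree

lemma ext' {τ σ : PlaneTree} (h : τ.verts = σ.verts) : τ = σ := by
  cases τ; cases σ; simp only at h; subst h; rfl

lemma mem_iff_of_initial (S : Set ℕ) (hfin : S.Finite) (hpos : ∀ i ∈ S, 1 ≤ i)
    (hdown : ∀ i, 1 ≤ i → i + 1 ∈ S → i ∈ S) (i : ℕ) : i ∈ S ↔ 1 ≤ i ∧ i ≤ S.ncard := by
  obtain ⟨m, hm⟩ : ∃ m, S = Set.Icc 1 m := by
    rcases S.eq_empty_or_nonempty with rfl | hne
    · exact ⟨0, by simp⟩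
    · obtain ⟨m, hm, hmax⟩ := S.exists_max_image id hfin hne
      refine ⟨m, ?_⟩
      ext j
      rw [Set.mem_Icc]
      refine ⟨fun h => ⟨hpos j h, hmax j h⟩, fun ⟨h1, h2⟩ => ?_⟩
      have key : ∀ d, d < m → m - d ∈ S := by
        intro d
        induction d with
        | zero => intro _; exact hm
        | succ d ih =>
          intro h
          refine hdown _ (by omega) ?_
          rw [show m - (d + 1) + 1 = m - d by omega]
          exact ih (by omega)
      have := key (m - j) (by omega)
      rwa [show m - (m - j) = j by omega] at this
  have hc : S.ncard = m := by
    rw [hm, ← Finset.coe_Icc, Set.ncard_coe_finset]; simp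
  rw [hc, hm, Set.mem_Icc]

lemma mem_child (τ : PlaneTree) (u : List ℕ) (i : ℕ) :
    u ++ [i] ∈ τ.verts ↔ 1 ≤ i ∧ i ≤ τ.kc u := by
  refine mem_iff_of_initial {i : ℕ | u ++ [i] ∈ τ.verts} ?_ ?_ ?_ i
  · refine Set.Finite.preimage ?_ τ.verts.finite_toSet
    intro a _ b _ h
    simpa using h
  · intro i hi
    exact τ.labels_pos _ hi i (by simp)
  · intro i hi h
    exact τ.children_closed u i hi h

lemma mem_singleton_iff (τ : PlaneTree) (i : ℕ) :
    [i] ∈ τ.verts ↔ 1 ≤ i ∧ i ≤ τ.kc [] := τ.mem_child [] i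

lemma head_le (τ : PlaneTree) {a : ℕ} {u : List ℕ} (h : a :: u ∈ τ.verts) : a ≤ τ.kc [] := by
  have : [a] ∈ τ.verts := τ.prefix_closed _ _ (by simp) h
  exact ((τ.mem_singleton_iff a).1 this).2

lemma kc_of_iff (τ : PlaneTree) (u : List ℕ) (k : ℕ)
    (h : ∀ i, u ++ [i] ∈ τ.verts ↔ 1 ≤ i ∧ i ≤ k) : τ.kc u = k := by
  unfold kc
  have : {i : ℕ | u ++ [i] ∈ τ.verts} = ↑(Finset.Icc 1 k) := by
    ext i; rw [Finset.coe_Icc, Set.mem_Icc]; exact h i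
  rw [this, Set.ncard_coe_finset]; simp

/-- The plane tree with a single vertex. -/
def single : PlaneTree where
  verts := {[]}
  root_mem := by simp
  prefix_closed := by
    intro u v h hv
    rw [Finset.mem_singleton] at *
    subst hv
    simpa using h
  labels_pos := by simp
  children_closed := by simp

/-- Add to `τ` a last child of the root, with subtree `σ`. -/
def graft (τ σ : PlaneTree) : PlaneTree where
  verts := τ.verts ∪ σ.verts.image (fun u => (τ.kc [] + 1) :: u)
  root_mem := Finset.mem_union_left _ τ.root_mem
  prefix_closed := by
    intro u v h hv
    rw [Finset.mem_union, Finset.mem_image] at *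
    rcases hv with hv | ⟨v', hv', rfl⟩
    · exact Or.inl (τ.prefix_closed u v h hv)
    · cases u with
      | nil => exact Or.inl τ.root_mem
      | cons a u =>
        rw [List.cons_prefix_cons] at h
        exact Or.inr ⟨u, σ.prefix_closed u v' h.2 hv', by rw [h.1]⟩
  labels_pos := by
    intro u hu i hi
    rw [Finset.mem_union, Finset.mem_image] at hu
    rcases hu with hu | ⟨v', hv', rfl⟩
    · exact τ.labels_pos u hu i hi
    · rcases List.mem_cons.1 hi with rfl | hi
      · omega
      · exact σ.labels_pos v' hv' i hi
  children_closed := by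
    intro u i hi h
    rw [Finset.mem_union, Finset.mem_image] at *
    rcases h with h | ⟨v', hv', h⟩
    · exact Or.inl (τ.children_closed u i hi h)
    · cases u with
      | nil =>
        left
        simp only [List.nil_append, List.cons.injEq] at h
        exact (τ.mem_child [] i).2 ⟨hi, by omega⟩
      | cons a u =>
        right
        simp only [List.cons_append, List.cons.injEq] at h
        obtain ⟨rfl, rfl⟩ := h
        exact ⟨u ++ [i], σ.children_closed u i hi hv', rfl⟩

lemma mem_graft {τ σ : PlaneTree} {u : List ℕ} : u ∈ (graft τ σ).verts ↔
    u ∈ τ.verts ∨ ∃ v ∈ σ.verts, (τ.kc [] + 1) :: v = u := by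
  unfold graft
  simp only [Finset.mem_union, Finset.mem_image]

lemma cons_mem_graft {τ σ : PlaneTree} {u : List ℕ} :
    (τ.kc [] + 1) :: u ∈ (graft τ σ).verts ↔ u ∈ σ.verts := by
  rw [mem_graft]
  constructor
  · rintro (h | ⟨v, hv, h⟩)
    · have := τ.head_le h; omega
    · simp only [List.cons.injEq, true_and] at h
      exact h ▸ hv
  · intro h; exact Or.inr ⟨u, h, rfl⟩

lemma mem_left_iff {τ σ : PlaneTree} {u : List ℕ} : u ∈ τ.verts ↔
    u ∈ (graft τ σ).verts ∧ u.head? ≠ some (τ.kc [] + 1) := by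
  rw [mem_graft]
  constructor
  · intro h
    refine ⟨Or.inl h, ?_⟩
    cases u with
    | nil => simp
    | cons a u => have := τ.head_le h; simp; omega
  · rintro ⟨h | ⟨v, hv, rfl⟩, h'⟩
    · exact h
    · simp at h'

lemma graft_disj (τ σ : PlaneTree) :
    Disjoint τ.verts (σ.verts.image (fun u => (τ.kc [] + 1) :: u)) := by
  rw [Finset.disjoint_left]
  intro u h h'
  obtain ⟨v, hv, rfl⟩ := Finset.mem_image.1 h'
  have := τ.head_le h
  omega

lemma card_graft (τ σ : PlaneTree) :
    (graft τ σ).verts.card = τ.verts.card + σ.verts.card := by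
  unfold graft
  rw [Finset.card_union_of_disjoint (graft_disj τ σ), Finset.card_image_of_injective]
  intro a b h
  simpa using h

lemma kc_graft_nil (τ σ : PlaneTree) : (graft τ σ).kc [] = τ.kc [] + 1 := by
  apply kc_of_iff
  intro i
  rw [mem_graft, List.nil_append, mem_singleton_iff]
  constructor
  · rintro (h | ⟨v, hv, h⟩)
    · omega
    · simp only [List.cons.injEq] at h; omega
  · intro h
    rcases Nat.lt_or_ge (τ.kc []) i with h' | h'
    · right
      refine ⟨[], σ.root_mem, ?_⟩
      rw [show i = τ.kc [] + 1 by omega]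
    · left; omega

lemma kc_graft_right (τ σ : PlaneTree) (u : List ℕ) :
    (graft τ σ).kc ((τ.kc [] + 1) :: u) = σ.kc u := by
  apply kc_of_iff
  intro i
  rw [List.cons_append, cons_mem_graft, mem_child]

lemma kc_graft_left (τ σ : PlaneTree) (u : List ℕ) (hu : u ∈ τ.verts) (hne : u ≠ []) :
    (graft τ σ).kc u = τ.kc u := by
  apply kc_of_iff
  intro i
  rw [← mem_child, mem_left_iff (τ := τ) (σ := σ)]
  refine ⟨fun h => ⟨h, ?_⟩, fun h => h.1⟩
  cases u with
  | nil => exact absurd rfl hne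
  | cons a u => have := τ.head_le hu; simp; omega

lemma prod_graft (m : ℕ → ℝ) (τ σ : PlaneTree) :
    ∏ u ∈ (graft τ σ).verts.erase [], m ((graft τ σ).kc u) =
      (∏ u ∈ τ.verts.erase [], m (τ.kc u)) * ((∏ u ∈ σ.verts.erase [], m (σ.kc u)) * m (σ.kc [])) := by
  have h1 : (graft τ σ).verts.erase [] = τ.verts.erase [] ∪
      σ.verts.image (fun u => (τ.kc [] + 1) :: u) := by
    ext u
    simp only [Finset.mem_erase, Finset.mem_union, mem_graft, Finset.mem_image]
    constructor
    · rintro ⟨h, h' | h'⟩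
      · exact Or.inl ⟨h, h'⟩
      · exact Or.inr h'
    · rintro (h | h)
      · exact ⟨h.1, Or.inl h.2⟩
      · refine ⟨?_, Or.inr h⟩
        obtain ⟨v, _, rfl⟩ := h
        simp
  rw [h1, Finset.prod_union ((graft_disj τ σ).mono_left (Finset.erase_subset _ _)),
    Finset.prod_image (by intro a _ b _ h; simpa using h), Finset.prod_erase_mul _ _ σ.root_mem]
  congr 1
  · refine Finset.prod_congr rfl fun u hu => ?_
    rw [Finset.mem_erase] at hu
    rw [kc_graft_left τ σ u hu.2 hu.1]
  · refine Finset.prod_congr rfl fun u hu => ?_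
    rw [kc_graft_right]

lemma graft_inj {τ σ τ' σ' : PlaneTree} (h : graft τ σ = graft τ' σ') : τ = τ' ∧ σ = σ' := by
  have hk : τ.kc [] = τ'.kc [] := by
    have := kc_graft_nil τ σ
    rw [h, kc_graft_nil] at this
    omega
  constructor
  · apply ext'
    ext u
    rw [mem_left_iff (τ := τ) (σ := σ), mem_left_iff (τ := τ') (σ := σ'), h, hk]
  · apply ext'
    ext u
    rw [← cons_mem_graft (τ := τ), ← cons_mem_graft (τ := τ') (σ := σ'), h, hk]

lemma kc_single : single.kc [] = 0 := by
  apply kc_of_iff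
  intro i
  simp [single]
  omega

lemma cases_graft (τ : PlaneTree) : τ = single ∨ ∃ τ1 τ2, τ = graft τ1 τ2 := by
  rcases Nat.eq_zero_or_pos (τ.kc []) with h0 | hpos
  · left
    apply ext'
    ext u
    simp only [single, Finset.mem_singleton]
    constructor
    · intro hu
      cases u with
      | nil => rfl
      | cons a u =>
        have := τ.head_le hu
        have := τ.labels_pos _ hu a (by simp)
        omega
    · rintro rfl; exact τ.root_mem
  · right
    obtain ⟨k, hk⟩ : ∃ k, τ.kc [] = k + 1 := ⟨τ.kc [] - 1, by omega⟩
    let τ1 : PlaneTree :=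
      { verts := τ.verts.filter (fun u => u.head? ≠ some (k + 1))
        root_mem := by simp [τ.root_mem]
        prefix_closed := by
          intro u v h hv
          rw [Finset.mem_filter] at *
          refine ⟨τ.prefix_closed u v h hv.1, ?_⟩
          cases u with
          | nil => simp
          | cons a u =>
            obtain ⟨v', rfl⟩ := h
            simpa using hv.2
        labels_pos := by
          intro u hu
          exact τ.labels_pos u (Finset.mem_filter.1 hu).1
        children_closed := by
          intro u i hi h
          rw [Finset.mem_filter] at *
          refine ⟨τ.children_closed u i hi h.1, ?_⟩
          cases u with
          | nil =>
            have := τ.head_le h.1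
            simp
            omega
          | cons a u => simpa using h.2 }
    have h11 : [k + 1] ∈ τ.verts := (τ.mem_singleton_iff _).2 (by omega)
    let τ2 : PlaneTree :=
      { verts := (τ.verts.filter (fun u => u.head? = some (k + 1))).image List.tail
        root_mem := by
          rw [Finset.mem_image]
          exact ⟨[k + 1], by simp [h11], rfl⟩
        prefix_closed := by
          intro u v h hv
          rw [Finset.mem_image] at *
          obtain ⟨v', hv', rfl⟩ := hv
          rw [Finset.mem_filter] at hv'
          refine ⟨(k + 1) :: u, ?_, rfl⟩
          cases v' with
          | nil => simp at hv'
          | cons a v' =>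
            simp only [List.head?_cons, Option.some.injEq] at hv'
            obtain ⟨hv1, rfl⟩ := hv'
            simp only [List.tail_cons] at h
            simp only [Finset.mem_filter, List.head?_cons, and_true]
            exact τ.prefix_closed _ _ (by simpa using h) hv1
        labels_pos := by
          intro u hu i hi
          rw [Finset.mem_image] at hu
          obtain ⟨v', hv', rfl⟩ := hu
          exact τ.labels_pos v' (Finset.mem_filter.1 hv').1 i (List.mem_of_mem_tail hi)
        children_closed := by
          intro u i hi h
          rw [Finset.mem_image] at *
          obtain ⟨v', hv', h⟩ := h
          rw [Finset.mem_filter] at hv'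
          refine ⟨(k + 1) :: (u ++ [i]), ?_, rfl⟩
          cases v' with
          | nil => simp at hv'
          | cons a v' =>
            simp only [List.head?_cons, Option.some.injEq] at hv'
            obtain ⟨hv1, rfl⟩ := hv'
            simp only [List.tail_cons] at h
            subst h
            simp only [Finset.mem_filter, List.head?_cons, and_true]
            exact τ.children_closed ((k + 1) :: u) i hi hv1 }
    have hk1 : τ1.kc [] = k := by
      apply kc_of_iff
      intro i
      have : [] ++ [i] ∈ τ1.verts ↔ [i] ∈ τ.verts ∧ i ≠ k + 1 := by
        simp [τ1]
      rw [this, mem_singleton_iff, hk]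
      omega
    refine ⟨τ1, τ2, ext' ?_⟩
    ext u
    rw [mem_graft, hk1]
    have m1 : u ∈ τ1.verts ↔ u ∈ τ.verts ∧ u.head? ≠ some (k + 1) := by
      simp only [τ1, Finset.mem_filter]
    have m2 : ∀ v, v ∈ τ2.verts ↔ (k + 1) :: v ∈ τ.verts := by
      intro v
      simp only [τ2, Finset.mem_image, Finset.mem_filter]
      constructor
      · rintro ⟨v', ⟨hv1, hv2⟩, rfl⟩
        cases v' with
        | nil => simp at hv2
        | cons a v' =>
          simp only [List.head?_cons, Option.some.injEq] at hv2
          subst hv2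
          exact hv1
      · intro h
        exact ⟨_, ⟨h, rfl⟩, rfl⟩
    simp only [m1, m2]
    constructor
    · intro hu
      by_cases hh : u.head? = some (k + 1)
      · right
        cases u with
        | nil => simp at hh
        | cons a u =>
          simp only [List.head?_cons, Option.some.injEq] at hh
          subst hh
          exact ⟨u, hu, rfl⟩
      · exact Or.inl ⟨hu, hh⟩
    · rintro (h | ⟨v, hv, rfl⟩)
      · exact h.1
      · exact hv

end PlaneTree

/-- The plane tree encoded by a binary tree. -/
def phiT : BinaryTree Unit → PlaneTree
  | .nil => PlaneTree.single
  | .node _ a b => PlaneTree.graft (phiT a) (phiT b)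

lemma kc_phiT (T : BinaryTree Unit) : (phiT T).kc [] = rdT T := by
  induction T with
  | nil => exact PlaneTree.kc_single
  | node _ a b iha _ => simp only [phiT, rdT, PlaneTree.kc_graft_nil, iha]

lemma card_phiT (T : BinaryTree Unit) : (phiT T).verts.card = T.numNodes + 1 := by
  induction T with
  | nil => rfl
  | node _ a b iha ihb =>
    simp only [phiT, BinaryTree.numNodes, PlaneTree.card_graft, iha, ihb]; omega

lemma prod_phiT (m : ℕ → ℝ) (T : BinaryTree Unit) :
    ∏ u ∈ (phiT T).verts.erase [], m ((phiT T).kc u) = wT m T := by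
  induction T with
  | nil => simp [phiT, PlaneTree.single, wT]
  | node _ a b iha ihb =>
    simp only [phiT, wT, PlaneTree.prod_graft, iha, ihb, kc_phiT]

lemma phiT_injective : Function.Injective phiT := by
  intro T
  induction T with
  | nil =>
    intro T' h
    cases T' with
    | nil => rfl
    | node _ a b =>
      have := congrArg (fun τ => PlaneTree.kc τ []) h
      simp only [kc_phiT, rdT] at this
      omega
  | node x a b iha ihb =>
    intro T' h
    cases T' with
    | nil =>
      have := congrArg (fun τ => PlaneTree.kc τ []) h
      simp only [kc_phiT, rdT] at this
      omega
    | node y a' b' =>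
      simp only [phiT] at h
      obtain ⟨h1, h2⟩ := PlaneTree.graft_inj h
      rw [iha h1, ihb h2]

lemma phiT_surjective : Function.Surjective phiT := by
  have : ∀ n, ∀ τ : PlaneTree, τ.verts.card = n → ∃ T, phiT T = τ := by
    intro n
    induction n using Nat.strong_induction_on with
    | _ n ih =>
    intro τ hτ
    rcases τ.cases_graft with rfl | ⟨τ1, τ2, rfl⟩
    · exact ⟨.nil, rfl⟩
    · rw [PlaneTree.card_graft] at hτ
      have h1 := Finset.card_pos.2 ⟨_, τ1.root_mem⟩
      have h2 := Finset.card_pos.2 ⟨_, τ2.root_mem⟩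
      obtain ⟨T1, e1⟩ := ih _ (by omega) τ1 rfl
      obtain ⟨T2, e2⟩ := ih _ (by omega) τ2 rfl
      exact ⟨.node () T1 T2, by simp only [phiT, e1, e2]⟩
  exact fun τ => this _ τ rfl

lemma bgwModMass_eq (μ0 μ : ℕ → ℝ) (n : ℕ) (hn : 1 ≤ n) :
    bgwModMass μ0 μ n = PS μ (n - 1) μ0 := by
  unfold bgwModMass PS
  rw [← finsum_mem_coe_finset]
  symm
  apply finsum_mem_eq_of_bijOn phiT
  · refine ⟨?_, phiT_injective.injOn, ?_⟩
    · intro T hT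
      rw [Finset.mem_coe, BinaryTree.mem_treesOfNumNodesEq] at hT
      change (phiT T).verts.card = n
      rw [card_phiT]; omega
    · intro τ hτ
      obtain ⟨T, rfl⟩ := phiT_surjective τ
      refine ⟨T, ?_, rfl⟩
      have : (phiT T).verts.card = n := hτ
      rw [card_phiT] at this
      rw [Finset.mem_coe, BinaryTree.mem_treesOfNumNodesEq]
      omega
  · intro T _
    unfold bgwModW
    rw [prod_phiT, kc_phiT]
    ring

lemma wT_scale (w : ℕ → ℝ) (a b : ℝ) (T : BinaryTree Unit) :
    wT (fun k => a * ((k : ℝ) + 1) * w (k + 1) * b ^ k) T * b ^ (rdT T) =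
      (a * b) ^ T.numNodes * wT (fun k => ((k : ℝ) + 1) * w (k + 1)) T := by
  induction T with
  | nil => simp [wT, rdT]
  | node x l r ihl ihr =>
    simp only [wT, rdT, BinaryTree.numNodes]
    have : ∀ (X Y z : ℝ), X * (Y * (a * ((rdT r : ℝ) + 1) * z * b ^ rdT r)) * b ^ (rdT l + 1) =
      (X * b ^ rdT l) * (Y * b ^ rdT r) * (a * b) * (((rdT r : ℝ) + 1) * z) := by
      intro X Y z; ring
    rw [this, ihl, ihr]
    ring

lemma PS_scale (w : ℕ → ℝ) (a b c : ℝ) (n : ℕ) :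
    PS (fun k => a * ((k : ℝ) + 1) * w (k + 1) * b ^ k) n (fun k => c * w k * b ^ k) =
      c * (a * b) ^ n * PS (fun k => ((k : ℝ) + 1) * w (k + 1)) n w := by
  unfold PS
  rw [Finset.mul_sum]
  refine Finset.sum_congr rfl fun T hT => ?_
  rw [BinaryTree.mem_treesOfNumNodesEq] at hT
  have := wT_scale w a b T
  rw [hT] at this
  calc _ = (wT (fun k => a * ((k : ℝ) + 1) * w (k + 1) * b ^ k) T * b ^ (rdT T)) * (c * w (rdT T)) := by
        ring
    _ = _ := by rw [this]; ring

/-- Orientation of a triangle in the complex plane. -/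
def orient (p q r : ℂ) : ℝ := (q.re - p.re) * (r.im - p.im) - (q.im - p.im) * (r.re - p.re)

lemma ncPos_eq (n k : ℕ) :
    (ncPos n k).re = Real.cos (2 * (Real.pi * k / n)) ∧
      (ncPos n k).im = - Real.sin (2 * (Real.pi * k / n)) := by
  have : ncPos n k = Complex.exp (((-(2 * (Real.pi * k / n)) : ℝ) : ℂ) * Complex.I) := by
    unfold ncPos
    congr 1
    push_cast
    ring
  rw [this, Complex.exp_ofReal_mul_I_re, Complex.exp_ofReal_mul_I_im, Real.cos_neg, Real.sin_neg]
  exact ⟨rfl, rfl⟩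

lemma trig_orient (x y z : ℝ) :
    (Real.cos (2*y) - Real.cos (2*x)) * (-Real.sin (2*z) - -Real.sin (2*x)) -
      (-Real.sin (2*y) - -Real.sin (2*x)) * (Real.cos (2*z) - Real.cos (2*x)) =
    - (4 * Real.sin (y - x) * Real.sin (z - y) * Real.sin (z - x)) := by
  have h1 : Real.cos (2*y) - Real.cos (2*x) = -2 * Real.sin (y + x) * Real.sin (y - x) := by
    rw [Real.cos_sub_cos]; congr 3 <;> ring
  have h2 : Real.cos (2*z) - Real.cos (2*x) = -2 * Real.sin (z + x) * Real.sin (z - x) := by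
    rw [Real.cos_sub_cos]; congr 3 <;> ring
  have h3 : Real.sin (2*z) - Real.sin (2*x) = 2 * Real.sin (z - x) * Real.cos (z + x) := by
    rw [Real.sin_sub_sin]; congr 3 <;> ring
  have h4 : Real.sin (2*y) - Real.sin (2*x) = 2 * Real.sin (y - x) * Real.cos (y + x) := by
    rw [Real.sin_sub_sin]; congr 3 <;> ring
  have h5 : Real.sin (z - y) = Real.sin (z + x) * Real.cos (y + x) - Real.cos (z + x) * Real.sin (y + x) := by
    rw [← Real.sin_sub]; congr 1; ring
  have h3' : -Real.sin (2*z) - -Real.sin (2*x) = -(2 * Real.sin (z - x) * Real.cos (z + x)) := by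
    rw [← h3]; ring
  have h4' : -Real.sin (2*y) - -Real.sin (2*x) = -(2 * Real.sin (y - x) * Real.cos (y + x)) := by
    rw [← h4]; ring
  rw [h1, h2, h3', h4', h5]
  ring

lemma sin_pos_aux {n i j : ℕ} (hij : i < j) (hj : j < n) :
    0 < Real.sin (Real.pi * j / n - Real.pi * i / n) := by
  have hn : (0:ℝ) < n := by exact_mod_cast (by omega : 0 < n)
  have hij' : (i:ℝ) < j := by exact_mod_cast hij
  have hj' : (j:ℝ) < n := by exact_mod_cast hj
  have hi : (0:ℝ) ≤ i := by positivity
  have e : Real.pi * j / n - Real.pi * i / n = Real.pi * ((j - i) / n) := by ring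
  rw [e]
  have h0 : (0:ℝ) < (j - i) / n := div_pos (by linarith) hn
  have h1 : ((j:ℝ) - i) / n < 1 := by rw [div_lt_one hn]; linarith
  apply Real.sin_pos_of_pos_of_lt_pi
  · exact mul_pos Real.pi_pos h0
  · nlinarith [Real.pi_pos]

lemma orient_neg {n i j k : ℕ} (hij : i < j) (hjk : j < k) (hk : k < n) :
    orient (ncPos n i) (ncPos n j) (ncPos n k) < 0 := by
  unfold orient
  rw [(ncPos_eq n i).1, (ncPos_eq n i).2, (ncPos_eq n j).1, (ncPos_eq n j).2, (ncPos_eq n k).1,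
    (ncPos_eq n k).2, trig_orient]
  have := mul_pos (mul_pos (sin_pos_aux hij (hjk.trans hk)) (sin_pos_aux hjk hk))
    (sin_pos_aux (hij.trans hjk) hk)
  nlinarith

lemma orient_rot (p q r : ℂ) : orient p q r = orient q r p := by unfold orient; ring
lemma orient_swap (p q r : ℂ) : orient p q r = - orient p r q := by unfold orient; ring
lemma orient_self (p q : ℂ) : orient p q p = 0 ∧ orient p q q = 0 := by
  unfold orient; constructor <;> ring

lemma mem_segment_crossing {a b c d : ℂ} (h1 : orient a c b < 0) (h2 : orient a c d < 0)
    (h3 : orient c b d < 0) (h4 : orient a b d < 0) :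
    ∃ z, z ∈ segment ℝ a b ∧ z ∈ segment ℝ c d := by
  have g1 : orient a b c = - orient a c b := orient_swap _ _ _
  have g2 : orient c d a = orient a c d := (orient_rot a c d).symm
  have g3 : orient c d b = - orient c b d := orient_swap _ _ _
  have hs : orient c d b - orient c d a = orient a b c - orient a b d := by unfold orient; ring
  have hpos : 0 < orient c d b - orient c d a := by linarith
  set S := orient c d b - orient c d a with hS
  refine ⟨(orient c d b / S) • a + (- orient c d a / S) • b,
    ⟨orient c d b / S, - orient c d a / S, by apply div_nonneg <;> linarith,
      by apply div_nonneg <;> linarith, by rw [← add_div, ← sub_eq_add_neg, ← hS, div_self hpos.ne'], rfl⟩,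
    ⟨- orient a b d / S, orient a b c / S, by apply div_nonneg <;> linarith,
      by apply div_nonneg <;> linarith, by rw [← add_div, neg_add_eq_sub, ← hs, div_self hpos.ne'], ?_⟩⟩
  apply Complex.ext
  · simp only [Complex.add_re, Complex.real_smul, Complex.re_ofReal_mul]
    rw [div_mul_eq_mul_div, div_mul_eq_mul_div, div_mul_eq_mul_div, div_mul_eq_mul_div, ← add_div,
      ← add_div]
    congr 1
    unfold orient; ring
  · simp only [Complex.add_im, Complex.real_smul, Complex.im_ofReal_mul]
    rw [div_mul_eq_mul_div, div_mul_eq_mul_div, div_mul_eq_mul_div, div_mul_eq_mul_div, ← add_div,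
      ← add_div]
    congr 1
    unfold orient; ring

lemma crossing_point {n a b c d : ℕ} (h1 : a < c) (h2 : c < b) (h3 : b < d) (hd : d < n) :
    ¬ (segment ℝ (ncPos n a) (ncPos n b) ∩ segment ℝ (ncPos n c) (ncPos n d) ⊆
      {z : ℂ | (z = ncPos n a ∨ z = ncPos n b) ∧ (z = ncPos n c ∨ z = ncPos n d)}) := by
  intro h
  have k1 := orient_neg h1 h2 (h3.trans hd)
  have k2 := orient_neg h1 (h2.trans h3) hd
  have k3 := orient_neg h2 h3 hd
  have k4 := orient_neg (h1.trans h2) h3 hd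
  obtain ⟨z, hz1, hz2⟩ := mem_segment_crossing k1 k2 k3 k4
  obtain ⟨e1 | e1, e2 | e2⟩ := h ⟨hz1, hz2⟩ <;> rw [e1] at e2
  · rw [e2] at k1; unfold orient at k1; ring_nf at k1; linarith
  · rw [e2] at k2; unfold orient at k2; ring_nf at k2; linarith
  · rw [e2] at k3; unfold orient at k3; ring_nf at k3; linarith
  · rw [e2] at k3; unfold orient at k3; ring_nf at k3; linarith

lemma orient_lin {a b c d z : ℂ} {p q : ℝ} (hpq : p + q = 1) (hz : p • c + q • d = z) :
    orient a b z = p * orient a b c + q * orient a b d := by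
  subst hz
  have : q = 1 - p := by linarith
  subst this
  unfold orient
  simp only [Complex.add_re, Complex.real_smul, Complex.re_ofReal_mul, Complex.add_im, Complex.im_ofReal_mul]
  ring

lemma noncrossing_aux {n a b c d : ℕ} (hab : a < b) (hb : b < n) (hcd : c < d) (hd : d < n)
    (hne : ¬ (a = c ∧ b = d)) (h1 : ¬ (a < c ∧ c < b ∧ b < d)) (h2 : ¬ (c < a ∧ a < d ∧ d < b)) :
    segment ℝ (ncPos n a) (ncPos n b) ∩ segment ℝ (ncPos n c) (ncPos n d) ⊆
      {z : ℂ | (z = ncPos n a ∨ z = ncPos n b) ∧ (z = ncPos n c ∨ z = ncPos n d)} := by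
  rintro z ⟨⟨p', q', -, -, hpq', hz'⟩, ⟨p, q, hp, hq, hpq, hz⟩⟩
  have L0 : orient (ncPos n a) (ncPos n b) z = 0 := by
    rw [orient_lin hpq' hz', (orient_self _ _).1, (orient_self _ _).2]; ring
  rw [orient_lin hpq hz] at L0
  have left : ∀ x, x < a → orient (ncPos n a) (ncPos n b) (ncPos n x) < 0 := fun x hx => by
    rw [← orient_rot]; exact orient_neg hx hab hb
  have right : ∀ x, b < x → x < n → orient (ncPos n a) (ncPos n b) (ncPos n x) < 0 := fun x hx hn =>
    orient_neg hab hx hn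
  have mid : ∀ x, a < x → x < b → 0 < orient (ncPos n a) (ncPos n b) (ncPos n x) := fun x hx hn => by
    rw [orient_swap]; linarith [orient_neg hx hn hb]
  have za : ∀ x, x = a → orient (ncPos n a) (ncPos n b) (ncPos n x) = 0 := fun x hx => by
    rw [hx, (orient_self _ _).1]
  have zb : ∀ x, x = b → orient (ncPos n a) (ncPos n b) (ncPos n x) = 0 := fun x hx => by
    rw [hx, (orient_self _ _).2]
  have out : ∀ x, x < n → (x < a ∨ b < x) → orient (ncPos n a) (ncPos n b) (ncPos n x) < 0 := by
    rintro x hx (h | h)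
    exacts [left x h, right x h hx]
  have fin_c : q = 0 → (c = a ∨ c = b) →
      (z = ncPos n a ∨ z = ncPos n b) ∧ (z = ncPos n c ∨ z = ncPos n d) := by
    intro hq hc
    have : z = ncPos n c := by
      rw [← hz, hq, (by linarith : p = 1)]; simp
    refine ⟨?_, Or.inl this⟩
    rcases hc with hc | hc <;> rw [this, hc] <;> simp
  have fin_d : p = 0 → (d = a ∨ d = b) →
      (z = ncPos n a ∨ z = ncPos n b) ∧ (z = ncPos n c ∨ z = ncPos n d) := by
    intro hq hc
    have : z = ncPos n d := by
      rw [← hz, hq, (by linarith : q = 1)]; simp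
    refine ⟨?_, Or.inr this⟩
    rcases hc with hc | hc <;> rw [this, hc] <;> simp
  have kill : ∀ x y : ℝ, p * x + q * y = 0 → ¬ ((x < 0 ∧ y < 0) ∨ (0 < x ∧ 0 < y)) := by
    rintro x y h (⟨hx, hy⟩ | ⟨hx, hy⟩)
    · rcases hp.eq_or_lt with h0 | h0
      · rw [← h0] at h hpq; nlinarith
      · nlinarith
    · rcases hp.eq_or_lt with h0 | h0
      · rw [← h0] at h hpq; nlinarith
      · nlinarith
  show (z = ncPos n a ∨ z = ncPos n b) ∧ (z = ncPos n c ∨ z = ncPos n d)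
  by_cases hc : c = a ∨ c = b
  · have hLc : orient (ncPos n a) (ncPos n b) (ncPos n c) = 0 := hc.elim (za c) (zb c)
    have hLd : orient (ncPos n a) (ncPos n b) (ncPos n d) ≠ 0 := by
      by_cases hdd : d < a ∨ b < d
      · exact (out d hd hdd).ne
      · exact (mid d (by omega) (by omega)).ne'
    rw [hLc] at L0
    refine fin_c ?_ hc
    simpa [hLd] using L0
  by_cases hd' : d = a ∨ d = b
  · have hLd : orient (ncPos n a) (ncPos n b) (ncPos n d) = 0 := hd'.elim (za d) (zb d)
    have hLc : orient (ncPos n a) (ncPos n b) (ncPos n c) ≠ 0 := by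
      by_cases hdd : c < a ∨ b < c
      · exact (out c (by omega) hdd).ne
      · exact (mid c (by omega) (by omega)).ne'
    rw [hLd] at L0
    refine fin_d ?_ hd'
    simpa [hLc] using L0
  exfalso
  apply kill _ _ L0
  by_cases hin : a < c ∧ c < b
  · exact Or.inr ⟨mid c hin.1 hin.2, mid d (by omega) (by omega)⟩
  · exact Or.inl ⟨out c (by omega) (by omega), out d hd (by omega)⟩

lemma noncrossing_of {n : ℕ} (E : Finset (ℕ × ℕ))
    (hE : ∀ e ∈ E, e.1 < e.2 ∧ e.2 < n)
    (nc : ∀ e ∈ E, ∀ f ∈ E, ¬ (e.1 < f.1 ∧ f.1 < e.2 ∧ e.2 < f.2))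
    (a b c d : ℕ) (h1 : (a, b) ∈ E ∨ (b, a) ∈ E) (h2 : (c, d) ∈ E ∨ (d, c) ∈ E)
    (hne : ({a, b} : Set ℕ) ≠ {c, d}) :
    segment ℝ (ncPos n a) (ncPos n b) ∩ segment ℝ (ncPos n c) (ncPos n d) ⊆
      {z : ℂ | (z = ncPos n a ∨ z = ncPos n b) ∧ (z = ncPos n c ∨ z = ncPos n d)} := by
  have key : ∀ a b c d : ℕ, (a, b) ∈ E → (c, d) ∈ E → ({a, b} : Set ℕ) ≠ {c, d} →
      segment ℝ (ncPos n a) (ncPos n b) ∩ segment ℝ (ncPos n c) (ncPos n d) ⊆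
      {z : ℂ | (z = ncPos n a ∨ z = ncPos n b) ∧ (z = ncPos n c ∨ z = ncPos n d)} := by
    intro a b c d h1 h2 hne
    refine noncrossing_aux (hE _ h1).1 (hE _ h1).2 (hE _ h2).1 (hE _ h2).2 ?_ (nc _ h1 _ h2) (nc _ h2 _ h1)
    rintro ⟨rfl, rfl⟩
    exact hne rfl
  rcases h1 with h1 | h1 <;> rcases h2 with h2 | h2
  · exact key _ _ _ _ h1 h2 hne
  · have := key _ _ _ _ h1 h2 (by rwa [Set.pair_comm d c])
    rw [segment_symm ℝ (ncPos n c)]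
    exact fun z hz => ⟨(this hz).1, (this hz).2.symm⟩
  · have := key _ _ _ _ h1 h2 (by rwa [Set.pair_comm b a])
    rw [segment_symm ℝ (ncPos n a)]
    exact fun z hz => ⟨(this hz).1.symm, (this hz).2⟩
  · have := key _ _ _ _ h1 h2 (by rwa [Set.pair_comm b a, Set.pair_comm d c])
    rw [segment_symm ℝ (ncPos n a), segment_symm ℝ (ncPos n c)]
    exact fun z hz => ⟨(this hz).1.symm, (this hz).2.symm⟩

/-- The graph on `Fin n` with edge set `E`. -/
def gr (n : ℕ) (E : Finset (ℕ × ℕ)) : SimpleGraph (Fin n) where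
  Adj i j := i ≠ j ∧ (((i : ℕ), (j : ℕ)) ∈ E ∨ ((j : ℕ), (i : ℕ)) ∈ E)
  symm := ⟨fun _ _ h => ⟨h.1.symm, h.2.symm⟩⟩
  loopless := ⟨fun _ h => h.1 rfl⟩

open Classical in
/-- The set of increasing edges of a graph on `Fin n`. -/
def eF {n : ℕ} (G : SimpleGraph (Fin n)) : Finset (ℕ × ℕ) :=
  (Finset.range n ×ˢ Finset.range n).filter
    (fun e => ∃ i j : Fin n, (i : ℕ) = e.1 ∧ (j : ℕ) = e.2 ∧ i < j ∧ G.Adj i j)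

lemma mem_eF {n : ℕ} (G : SimpleGraph (Fin n)) (e : ℕ × ℕ) :
    e ∈ eF G ↔ ∃ i j : Fin n, (i : ℕ) = e.1 ∧ (j : ℕ) = e.2 ∧ i < j ∧ G.Adj i j := by
  classical
  unfold eF
  rw [Finset.mem_filter]
  refine ⟨fun h => h.2, fun h => ⟨?_, h⟩⟩
  obtain ⟨i, j, h1, h2, -, -⟩ := h
  have := i.2
  have := j.2
  simp; omega

lemma mem_eF_fin {n : ℕ} (G : SimpleGraph (Fin n)) (i j : Fin n) :
    ((i : ℕ), (j : ℕ)) ∈ eF G ↔ i < j ∧ G.Adj i j := by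
  rw [mem_eF]
  constructor
  · rintro ⟨i', j', h1, h2, h3⟩
    rw [Fin.ext h1, Fin.ext h2] at h3
    exact h3
  · exact fun h => ⟨i, j, rfl, rfl, h⟩

lemma eF_supp {n : ℕ} (G : SimpleGraph (Fin n)) : ∀ e ∈ eF G, e.1 < e.2 ∧ e.2 < n := by
  intro e he
  rw [mem_eF] at he
  obtain ⟨i, j, h1, h2, h3, -⟩ := he
  have := j.2
  have : (i : ℕ) < j := h3
  omega

lemma gr_eF {n : ℕ} (G : SimpleGraph (Fin n)) : gr n (eF G) = G := by
  ext i j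
  show i ≠ j ∧ (((i : ℕ), (j : ℕ)) ∈ eF G ∨ ((j : ℕ), (i : ℕ)) ∈ eF G) ↔ _
  rw [mem_eF_fin, mem_eF_fin]
  constructor
  · rintro ⟨-, h | h⟩
    exacts [h.2, h.2.symm]
  · intro h
    refine ⟨h.ne, ?_⟩
    rcases lt_or_gt_of_ne h.ne with h' | h'
    exacts [Or.inl ⟨h', h⟩, Or.inr ⟨h', h.symm⟩]

lemma eF_gr {n : ℕ} (E : Finset (ℕ × ℕ)) (hE : ∀ e ∈ E, e.1 < e.2 ∧ e.2 < n) :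
    eF (gr n E) = E := by
  ext ⟨a, b⟩
  rw [mem_eF]
  constructor
  · rintro ⟨i, j, h1, h2, h3, -, h | h⟩
    · simp only at h1 h2; rwa [h1, h2] at h
    · have := (hE _ h).1
      have h3' : (i : ℕ) < j := h3
      simp only at this; omega
  · intro h
    have := hE _ h
    simp only at this
    exact ⟨⟨a, by omega⟩, ⟨b, by omega⟩, rfl, rfl, this.1,
      fun h => by have := congrArg Fin.val h; simp only at this; omega, Or.inl h⟩

lemma reach_closed {n : ℕ} {E : Finset (ℕ × ℕ)} {i j : Fin n} (h : (gr n E).Reachable i j)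
    {P : ℕ → Prop} (hP : CClosed E P) : P i ↔ P j := by
  obtain ⟨p⟩ := h
  induction p with
  | nil => rfl
  | cons h p ih =>
    rw [← ih]
    rcases h.2 with h | h
    · exact hP _ h
    · exact (hP _ h).symm

lemma cconn_iff {n : ℕ} (hn : 1 ≤ n) {E : Finset (ℕ × ℕ)} (hE : ∀ e ∈ E, e.1 < e.2 ∧ e.2 < n) :
    CConn 0 (n - 1) E ↔ (gr n E).Preconnected := by
  constructor
  · intro h i j
    have := h (fun v => ∃ hv : v < n, (gr n E).Reachable i ⟨v, hv⟩) ?_ i j (by omega) (by omega)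
      (by omega) (by omega) ⟨i.2, by rfl⟩
    · obtain ⟨_, h⟩ := this
      exact h
    · intro e he
      have h1 := hE e he
      have hadj : (gr n E).Adj ⟨e.1, by omega⟩ ⟨e.2, by omega⟩ :=
        ⟨fun h => by have := congrArg Fin.val h; simp only at this; omega, Or.inl he⟩
      constructor
      · rintro ⟨_, h⟩
        exact ⟨h1.2, h.trans hadj.reachable⟩
      · rintro ⟨_, h⟩
        exact ⟨by omega, h.trans hadj.symm.reachable⟩
  · intro h P hP u v _ hu _ hv
    exact (reach_closed (h ⟨u, by omega⟩ ⟨v, by omega⟩) hP).1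

lemma gr_erase {n : ℕ} {E : Finset (ℕ × ℕ)} (hE : ∀ e ∈ E, e.1 < e.2 ∧ e.2 < n) (i j : Fin n)
    (hij : i < j) :
    (gr n E).deleteEdges {s(i, j)} = gr n (E.erase ((i : ℕ), (j : ℕ))) := by
  ext k l
  rw [SimpleGraph.deleteEdges_adj]
  show (k ≠ l ∧ (((k : ℕ), (l : ℕ)) ∈ E ∨ ((l : ℕ), (k : ℕ)) ∈ E)) ∧ _ ↔
    (k ≠ l ∧ (((k : ℕ), (l : ℕ)) ∈ E.erase ((i : ℕ), (j : ℕ)) ∨ ((l : ℕ), (k : ℕ)) ∈ E.erase ((i : ℕ), (j : ℕ))))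
  simp only [Set.mem_singleton_iff, Sym2.eq_iff, Finset.mem_erase, ne_eq, Prod.mk.injEq, ← Fin.ext_iff]
  have h1 := hE ((k : ℕ), (l : ℕ))
  have h2 := hE ((l : ℕ), (k : ℕ))
  simp only [Fin.val_fin_lt] at h1 h2
  constructor
  · rintro ⟨⟨h, h' | h'⟩, h''⟩
    · exact ⟨h, Or.inl ⟨by tauto, h'⟩⟩
    · exact ⟨h, Or.inr ⟨by tauto, h'⟩⟩
  · rintro ⟨h, ⟨h', h''⟩ | ⟨h', h''⟩⟩
    · refine ⟨⟨h, Or.inl h''⟩, ?_⟩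
      rintro (hh | ⟨rfl, rfl⟩)
      · exact h' hh
      · exact absurd (h1 h'').1 hij.asymm
    · refine ⟨⟨h, Or.inr h''⟩, ?_⟩
      rintro (⟨rfl, rfl⟩ | hh)
      · exact absurd (h2 h'').1 hij.asymm
      · exact h' hh.symm

lemma gr_isTree {n : ℕ} (hn : 1 ≤ n) {E : Finset (ℕ × ℕ)} (hE : ∀ e ∈ E, e.1 < e.2 ∧ e.2 < n) :
    (gr n E).IsTree ↔ CConn 0 (n - 1) E ∧ ∀ e ∈ E, ¬ CConn 0 (n - 1) (E.erase e) := by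
  have hEe : ∀ e', ∀ e ∈ E.erase e', e.1 < e.2 ∧ e.2 < n := fun e' e he =>
    hE e (Finset.mem_of_mem_erase he)
  have hne : Nonempty (Fin n) := ⟨⟨0, by omega⟩⟩
  constructor
  · intro h
    refine ⟨(cconn_iff hn hE).2 h.1.preconnected, ?_⟩
    rintro ⟨a, b⟩ he hc
    have hab := hE _ he
    simp only at hab
    rw [cconn_iff hn (hEe _)] at hc
    have hac := h.2
    rw [SimpleGraph.isAcyclic_iff_forall_isBridge] at hac
    let i : Fin n := ⟨a, by omega⟩
    let j : Fin n := ⟨b, by omega⟩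
    have hij : i < j := hab.1
    have hadj : (gr n E).Adj i j := ⟨hij.ne, Or.inl he⟩
    have := hac ((SimpleGraph.mem_edgeSet _).2 hadj)
    rw [SimpleGraph.isBridge_iff, gr_erase hE i j hij] at this
    exact this (hc i j)
  · rintro ⟨h1, h2⟩
    refine ⟨⟨(cconn_iff hn hE).1 h1⟩, ?_⟩
    rw [SimpleGraph.isAcyclic_iff_forall_isBridge]
    have key : ∀ i j : Fin n, i < j → (gr n E).Adj i j → (gr n E).IsBridge s(i, j) := by
      intro i j hij hadj
      rw [SimpleGraph.isBridge_iff, gr_erase hE i j hij]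
      have hm : ((i : ℕ), (j : ℕ)) ∈ E := by
        rcases hadj.2 with h | h
        · exact h
        · have := (hE _ h).1
          have : (i : ℕ) < j := hij
          simp only at *; omega
      intro hr
      apply h2 _ hm
      intro P hP
      refine h1 P ?_
      intro e he
      by_cases hee : e = ((i : ℕ), (j : ℕ))
      · rw [hee]; exact reach_closed hr hP
      · exact hP e (Finset.mem_erase.2 ⟨hee, he⟩)
    intro e
    induction e using Sym2.ind with
    | _ i j =>
      intro he
      rw [SimpleGraph.mem_edgeSet] at he
      rcases lt_or_gt_of_ne he.ne with h' | h'
      · exact key _ _ h' he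
      · rw [Sym2.eq_swap]; exact key _ _ h' he.symm

lemma isT_eF {n : ℕ} (hn : 1 ≤ n) (θ : NCTree n) : IsT 0 (n - 1) (eF θ.adj) := by
  have ht := θ.isTree
  rw [← gr_eF θ.adj, gr_isTree hn (eF_supp _)] at ht
  refine ⟨fun e he => ?_, ?_, ht.1, ht.2⟩
  · have := eF_supp _ e he
    omega
  · rintro ⟨a, b⟩ he ⟨c, d⟩ hf ⟨h1, h2, h3⟩
    simp only at h1 h2 h3
    have hd := (eF_supp _ _ hf).2
    simp only at hd
    refine crossing_point h1 h2 h3 hd ?_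
    have h4 : θ.adj.Adj ⟨a, by omega⟩ ⟨b, by omega⟩ :=
      ((mem_eF_fin θ.adj ⟨a, by omega⟩ ⟨b, by omega⟩).1 he).2
    have h5 : θ.adj.Adj ⟨c, by omega⟩ ⟨d, by omega⟩ :=
      ((mem_eF_fin θ.adj ⟨c, by omega⟩ ⟨d, by omega⟩).1 hf).2
    suffices hne : ({a, b} : Set ℕ) ≠ {c, d} by
      exact θ.noncrossing ⟨a, by omega⟩ ⟨b, by omega⟩ ⟨c, by omega⟩ ⟨d, by omega⟩ h4 h5 hne
    intro h
    have : a ∈ ({c, d} : Set ℕ) := by rw [← h]; simp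
    simp only [Set.mem_insert_iff, Set.mem_singleton_iff] at this
    omega

lemma NCTree_ext {n : ℕ} {θ θ' : NCTree n} (h : θ.adj = θ'.adj) : θ = θ' := by
  cases θ; cases θ'; simp only at h; subst h; rfl

/-- The noncrossing tree with a given edge set. -/
def mkNC {n : ℕ} (hn : 1 ≤ n) (E : Finset (ℕ × ℕ)) (h : IsT 0 (n - 1) E) : NCTree n where
  adj := gr n E
  isTree := (gr_isTree hn (fun e he => by have := h.supp e he; omega)).2 ⟨h.conn, h.min⟩
  noncrossing := fun a b c d h1 h2 hne =>
    noncrossing_of E (fun e he => by have := h.supp e he; omega) h.nc a b c d h1.2 h2.2 hne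

lemma ncDeg_eq {n : ℕ} (θ : NCTree n) (v : Fin n) : ncDeg n θ v = dg (eF θ.adj) v := by
  unfold ncDeg dg
  rw [← Set.ncard_coe_finset]
  refine Set.ncard_congr (fun (x : Fin n) _ => ((min v x : Fin n).val, (max v x : Fin n).val)) ?_ ?_ ?_
  · intro x hx
    have hx : θ.adj.Adj v x := hx
    rw [Finset.mem_coe, Finset.mem_filter, mem_eF_fin]
    rcases lt_or_gt_of_ne hx.ne with h | h
    · rw [min_eq_left h.le, max_eq_right h.le]
      exact ⟨⟨h, hx⟩, Or.inl rfl⟩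
    · rw [min_eq_right h.le, max_eq_left h.le]
      exact ⟨⟨h, hx.symm⟩, Or.inr rfl⟩
  · intro x y _ _ h
    simp only [Prod.mk.injEq, ← Fin.ext_iff] at h
    have h1 := h.1
    have h2 := h.2
    rcases le_total v x with a | a <;> rcases le_total v y with b | b <;>
      simp only [min_eq_left, min_eq_right, max_eq_left, max_eq_right, a, b] at h1 h2
    · exact h2
    · rw [h2, h1]
    · rw [h1, h2]
    · exact h1
  · rintro ⟨a, b⟩ h
    rw [Finset.mem_coe, Finset.mem_filter, mem_eF] at h
    obtain ⟨⟨i, j, rfl, h2, hij, hadj⟩, h⟩ := h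
    simp only at h2
    subst h2
    simp only [← Fin.ext_iff] at h
    rcases h with rfl | rfl
    · exact ⟨j, hadj, by rw [min_eq_left hij.le, max_eq_right hij.le]⟩
    · exact ⟨i, hadj.symm, by rw [min_eq_right hij.le, max_eq_left hij.le]⟩

lemma ncWeight_eq {n : ℕ} (hn : 1 ≤ n) (w : ℕ → ℝ) (θ : NCTree n) :
    ncWeight n w θ = w (dg (eF θ.adj) 0) * ∏ v ∈ Finset.Ioc 0 (n - 1), w (dg (eF θ.adj) v) := by
  unfold ncWeight
  simp only [ncDeg_eq]
  rw [Fin.prod_univ_eq_prod_range (fun v => w (dg (eF θ.adj) v)) n]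
  have : Finset.range n = insert 0 (Finset.Ioc 0 (n - 1)) := by
    ext x; simp; omega
  rw [this, Finset.prod_insert (by simp)]

lemma finsum_nc {n : ℕ} (hn : 1 ≤ n) (w : ℕ → ℝ) :
    (∑ᶠ θ : NCTree n, ncWeight n w θ) = NL w 0 (n - 1) w := by
  unfold NL
  rw [← finsum_mem_univ, ← finsum_mem_coe_finset]
  refine finsum_mem_eq_of_bijOn (fun θ : NCTree n => eF θ.adj) ⟨?_, ?_, ?_⟩ ?_
  · intro θ _
    exact mem_ncTrees.2 (isT_eF hn θ)
  · intro θ _ θ' _ h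
    apply NCTree_ext
    rw [← gr_eF θ.adj, ← gr_eF θ'.adj]
    exact congrArg (gr n) h
  · intro E hE
    have hE := mem_ncTrees.1 (Finset.mem_coe.1 hE)
    exact ⟨mkNC hn E hE, Set.mem_univ _, eF_gr E (fun e he => by have := hE.supp e he; omega)⟩
  · intro θ _
    exact ncWeight_eq hn w θ

/-- With `ρ = (limsup w(k)^{1/k})⁻¹ > 0`, `b ∈ (0,ρ)`,
`a = (Σ (k+1) w(k+1) bᵏ)⁻¹`, `c = (Σ w(k) bᵏ)⁻¹`, `μ(k) = a (k+1) w(k+1) bᵏ` and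
`μ_∅(k) = c w(k) bᵏ`, for every `n ≥ 1` the partition function of simply generated
noncrossing trees satisfies `Z_n^w = BGW^{μ_∅,μ}(T_n) / (c (ab)^{n-1})`. -/
theorem partition_function_eq (w : ℕ → ℝ) (hw : ∀ k, 0 ≤ w k)
    (hρpos : 0 < (Filter.limsup
      (fun k : ℕ => ENNReal.ofReal (w k) ^ ((k : ℝ)⁻¹)) Filter.atTop)⁻¹)
    (b : ℝ) (hb : 0 < b)
    (hbρ : ENNReal.ofReal b < (Filter.limsup
      (fun k : ℕ => ENNReal.ofReal (w k) ^ ((k : ℝ)⁻¹)) Filter.atTop)⁻¹)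
    (A C : ℝ) (hA : HasSum (fun k : ℕ => ((k : ℝ) + 1) * w (k + 1) * b ^ k) A) (hApos : 0 < A)
    (hC : HasSum (fun k : ℕ => w k * b ^ k) C) (hCpos : 0 < C)
    (n : ℕ) (hn : 1 ≤ n) :
    (∑ᶠ θ : NCTree n, ncWeight n w θ) =
      bgwModMass (fun k => C⁻¹ * w k * b ^ k)
          (fun k => A⁻¹ * ((k : ℝ) + 1) * w (k + 1) * b ^ k) n /
        (C⁻¹ * (A⁻¹ * b) ^ (n - 1)) := by
  have h := NL_eq_PS w (n - 1) 0 w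
  rw [zero_add] at h
  rw [finsum_nc hn, h, bgwModMass_eq _ _ n hn, PS_scale]
  have hpos : C⁻¹ * (A⁻¹ * b) ^ (n - 1) ≠ 0 := by positivity
  rw [mul_div_cancel_left₀ _ hpos]

end
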